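/- arXiv:2406.13630 — 3 statements merged into one kernel-verified Lean document; each statement's English description precedes it below -/
import Mathlib

section
/- Fix integers N ≥ 1 and ℓ ≥ 1 with N ≡ ℓ (mod 2). For a {2,3}-word u of level ℓ−1 with weight(u) < N−1, the number r defined by 2r = N − 1 − weight(u) is a positive integer, and the map ψ sending u to the word (2,…,2,3)·u consisting of r−1 letters 2, one letter 3, and then u, is a bijection from the set of {2,3}-words of level ℓ−1 and weight < N−1 onto the set of {2,3}-words of level ℓ and weight N. -/
theorem sum_mod_two_eq_count_three_mod_two {u : List ℕ} (hu : ∀ x ∈ u, x = 2 ∨ x = 3) :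
    u.sum % 2 = u.count 3 % 2 := by
  induction u with
  | nil => simp
  | cons a t ih =>
    have ht := ih fun x hx => hu x (List.mem_cons_of_mem _ hx)
    rcases hu a List.mem_cons_self with rfl | rfl <;> simp <;> omega

theorem replicate_two_append_three_cons_right_injective {a b : ℕ} {u v : List ℕ}
    (h : List.replicate a 2 ++ 3 :: u = List.replicate b 2 ++ 3 :: v) : u = v := by
  induction a generalizing b with
  | zero => cases b <;> simp_all [List.replicate_succ]
  | succ a ih =>
    cases b with
    | zero => simp [List.replicate_succ] at h
    | succ b => exact ih (by simpa [List.replicate_succ] using h)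

theorem exists_eq_replicate_two_append_three_cons {w : List ℕ}
    (hw : ∀ x ∈ w, x = 2 ∨ x = 3) (h3 : 3 ∈ w) :
    ∃ (a : ℕ) (u : List ℕ), w = List.replicate a 2 ++ 3 :: u := by
  induction w with
  | nil => simp at h3
  | cons x t ih =>
    rcases hw x List.mem_cons_self with rfl | rfl
    · obtain ⟨a, u, rfl⟩ := ih (fun x hx => hw x (List.mem_cons_of_mem _ hx)) (by simpa using h3)
      exact ⟨a + 1, u, by simp [List.replicate_succ]⟩
    · exact ⟨0, t, by simp⟩


/-- For `N, ℓ ≥ 1` with `N ≡ ℓ (mod 2)`: for every `{2,3}`-word `u` of level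
`ℓ−1` and weight `< N−1`, the number `r` with `2r = N − 1 − weight(u)` is a positive
integer, and the map `u ↦ 2^{r−1} 3 u` is a bijection from the set of `{2,3}`-words of
level `ℓ−1` and weight `< N−1` onto the set of `{2,3}`-words of level `ℓ` and weight `N`. -/
theorem word23_bijection (N ℓ : ℕ) (hN : 1 ≤ N) (hℓ : 1 ≤ ℓ) (hpar : N % 2 = ℓ % 2) :
    (∀ u : List ℕ, ((∀ x ∈ u, x = 2 ∨ x = 3) ∧ u.count 3 = ℓ - 1 ∧ u.sum < N - 1) →
      (N - 1 - u.sum) % 2 = 0 ∧ 1 ≤ (N - 1 - u.sum) / 2) ∧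
    Set.BijOn (fun u : List ℕ => List.replicate ((N - 1 - u.sum) / 2 - 1) 2 ++ 3 :: u)
      {u : List ℕ | (∀ x ∈ u, x = 2 ∨ x = 3) ∧ u.count 3 = ℓ - 1 ∧ u.sum < N - 1}
      {u : List ℕ | (∀ x ∈ u, x = 2 ∨ x = 3) ∧ u.count 3 = ℓ ∧ u.sum = N} := by
  have key : ∀ u : List ℕ, ((∀ x ∈ u, x = 2 ∨ x = 3) ∧ u.count 3 = ℓ - 1 ∧ u.sum < N - 1) →
      (N - 1 - u.sum) % 2 = 0 ∧ 1 ≤ (N - 1 - u.sum) / 2 := by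
    rintro u ⟨hu, hc, hs⟩
    have := sum_mod_two_eq_count_three_mod_two hu
    omega
  refine ⟨key, ?_, ?_, ?_⟩
  · rintro u ⟨hu, hc, hs⟩
    obtain ⟨h0, h1⟩ := key u ⟨hu, hc, hs⟩
    refine ⟨?_, ?_, ?_⟩
    · intro x hx
      rcases List.mem_append.1 hx with hx | hx
      · exact Or.inl (List.eq_of_mem_replicate hx)
      · rcases List.mem_cons.1 hx with hx | hx
        · exact Or.inr hx
        · exact hu x hx
    · simp [List.count_replicate]
      omega
    · simp
      omega
  · intro u _ v _ h
    exact replicate_two_append_three_cons_right_injective h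
  · rintro w ⟨hw, hc, hs⟩
    obtain ⟨a, u, rfl⟩ := exists_eq_replicate_two_append_three_cons hw
      (List.count_pos_iff.1 (by omega))
    simp [List.count_replicate] at hc hs
    refine ⟨u, ⟨fun x hx => hw x (by simp [hx]), by omega, by omega⟩, ?_⟩
    have : (N - 1 - u.sum) / 2 - 1 = a := by omega
    simp [this]
end

section
/- (Zagier) For all integers a, b ≥ 0 one has the identity of real numbers ζ({2}^a, 3, {2}^b) = Σ_{r=1}^{a+b+1} c_{a,b}^r · ζ(2r+1) · ζ({2}^{a+b+1−r}), where ζ(2r+1) = Σ_{n≥1} n^{−(2r+1)} and ζ({2}^0) = 1. -/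
/-- The multiple zeta value `ζ(k₁,…,k_d) = Σ_{n₁ > ⋯ > n_d > 0} 1/(n₁^{k₁} ⋯ n_d^{k_d})`
associated to an index list `ks = [k₁,…,k_d]` (equal to `1` for the empty index). -/
noncomputable def mzv (ks : List ℕ) : ℝ :=
  ∑' n : {f : Fin ks.length → ℕ // StrictAnti f ∧ ∀ i, 0 < f i},
    ∏ i : Fin ks.length, (1 : ℝ) / ((n.1 i : ℝ) ^ ks.get i)
/-- The rational numbers `c_{a,b}^r = 2·(−1)^r·( C(2r, 2b+2) − (1 − 2^{−2r})·C(2r, 2a+1) )`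
appearing in Zagier's formula. -/
def cZ (a b r : ℕ) : ℚ :=
  2 * (-1) ^ r * (((2 * r).choose (2 * b + 2) : ℚ)
    - (1 - (2 : ℚ) ^ (-(2 * (r : ℤ)))) * ((2 * r).choose (2 * a + 1) : ℚ))

open Finset Filter Topology Real

namespace ZagierFormula

/-! ### Truncated multiple zeta values with values in `ℝ≥0∞` -/

/-- The term `1 / n ^ k`, which vanishes at `n = 0` when `k ≠ 0`. -/
noncomputable def invPow (k n : ℕ) : ENNReal := ENNReal.ofReal (1 / (n : ℝ) ^ k)

/-- The multiple zeta value truncated to summation variables smaller than `N`. -/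
noncomputable def mzvBelow (ks : List ℕ) (N : ℕ∞) : ENNReal :=
  open Classical in
  ∑' f : Fin ks.length → ℕ,
    if StrictAnti f ∧ ∀ i, 0 < f i ∧ (f i : ℕ∞) < N then ∏ i, invPow (ks.get i) (f i) else 0

theorem mzv_eq_toReal (ks : List ℕ) : mzv ks = (mzvBelow ks ⊤).toReal := by
  classical
  have h : mzvBelow ks ⊤ =
      ∑' n : {f : Fin ks.length → ℕ // StrictAnti f ∧ ∀ i, 0 < f i},
        ∏ i, invPow (ks.get i) (n.1 i) := by
    rw [mzvBelow]
    have := tsum_subtype {f : Fin ks.length → ℕ | StrictAnti f ∧ ∀ i, 0 < f i}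
      (fun f => ∏ i, invPow (ks.get i) (f i))
    refine Eq.trans ?_ this.symm
    refine tsum_congr fun f => ?_
    simp [Set.indicator_apply]
  rw [h, ENNReal.tsum_toReal_eq, mzv]
  · refine tsum_congr fun f => ?_
    rw [ENNReal.toReal_prod]
    refine Finset.prod_congr rfl fun i _ => ?_
    rw [invPow, ENNReal.toReal_ofReal (by positivity)]
  · exact fun f => ENNReal.prod_ne_top fun i _ => ENNReal.ofReal_ne_top

theorem mzvBelow_nil (N : ℕ∞) : mzvBelow [] N = 1 := by
  classical
  rw [mzvBelow]
  rw [tsum_eq_single (fun i : Fin ([] : List ℕ).length => (Fin.elim0 i : ℕ))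
    (fun f hf => absurd (funext fun i => Fin.elim0 i) hf)]
  rw [if_pos ⟨fun i => Fin.elim0 i, fun i => Fin.elim0 i⟩]
  exact Fin.prod_univ_zero _

theorem strictAnti_cons_iff {l : ℕ} (n : ℕ) (f : Fin l → ℕ) :
    StrictAnti (Fin.cons n f : Fin (l + 1) → ℕ) ↔ StrictAnti f ∧ ∀ i, f i < n := by
  constructor
  · intro h
    refine ⟨fun i j hij => ?_, fun i => ?_⟩
    · simpa using h (Fin.succ_lt_succ_iff.2 hij)
    · simpa using h (Fin.succ_pos i)
  · rintro ⟨h, hn⟩ i j hij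
    induction j using Fin.cases with
    | zero => exact absurd hij (Fin.not_lt_zero i)
    | succ j =>
      induction i using Fin.cases with
      | zero => simpa using hn j
      | succ i => simpa using h (Fin.succ_lt_succ_iff.1 hij)

theorem mzvBelow_cons (k : ℕ) (hk : k ≠ 0) (ks : List ℕ) (N : ℕ∞) :
    mzvBelow (k :: ks) N =
      ∑' n : ℕ, if (n : ℕ∞) < N then invPow k n * mzvBelow ks n else 0 := by
  classical
  have h1 : mzvBelow (k :: ks) N = ∑' p : ℕ × (Fin ks.length → ℕ),
      if StrictAnti (Fin.cons p.1 p.2 : Fin (ks.length + 1) → ℕ) ∧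
        ∀ i, 0 < (Fin.cons p.1 p.2 : Fin (ks.length + 1) → ℕ) i ∧
          (((Fin.cons p.1 p.2 : Fin (ks.length + 1) → ℕ) i : ℕ) : ℕ∞) < N
      then invPow k p.1 * ∏ i, invPow (ks.get i) (p.2 i) else 0 := by
    rw [mzvBelow]
    refine Eq.trans ?_ ((Fin.consEquiv (fun _ : Fin (ks.length + 1) => ℕ)).tsum_eq
      (fun f : Fin (ks.length + 1) → ℕ =>
        if StrictAnti f ∧ ∀ i, 0 < f i ∧ (f i : ℕ∞) < N
        then ∏ i, invPow ((k :: ks).get i) (f i) else 0)).symm |>.trans ?_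
    · rfl
    · refine tsum_congr fun p => ?_
      congr 1
      exact Fin.prod_univ_succ _
  rw [h1, ENNReal.tsum_prod']
  refine tsum_congr fun n => ?_
  rcases Nat.eq_zero_or_pos n with rfl | hn
  · simp [invPow, hk]
  split_ifs with hN
  · rw [mzvBelow, ← ENNReal.tsum_mul_left]
    refine tsum_congr fun f => ?_
    rw [mul_ite, mul_zero]
    refine if_congr ?_ rfl rfl
    rw [strictAnti_cons_iff]
    simp only [Fin.forall_fin_succ, Fin.cons_zero, Fin.cons_succ, Nat.cast_lt]
    constructor
    · rintro ⟨⟨h, h2⟩, h3, h4⟩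
      exact ⟨h, fun i => ⟨(h4 i).1, h2 i⟩⟩
    · rintro ⟨h, h2⟩
      exact ⟨⟨h, fun i => (h2 i).2⟩, ⟨hn, hN⟩,
        fun i => ⟨(h2 i).1, lt_trans (Nat.cast_lt.2 (h2 i).2) hN⟩⟩
  · refine ENNReal.tsum_eq_zero.2 fun f => if_neg fun h => hN ?_
    simpa using (h.2 0).2

/-- The truncated multiple zeta value `ζ_{<n}({2}^b)`. -/
noncomputable def headSum : ℕ → ℕ → ℝ
  | 0, _ => 1
  | b + 1, n => ∑ m ∈ range n, 1 / (m : ℝ) ^ 2 * headSum b m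

theorem headSum_nonneg (b n : ℕ) : 0 ≤ headSum b n := by
  induction b generalizing n with
  | zero => simp [headSum]
  | succ b ih => exact Finset.sum_nonneg fun m _ => mul_nonneg (by positivity) (ih m)

theorem headSum_succ_succ (b n : ℕ) :
    headSum (b + 1) (n + 1) = headSum (b + 1) n + 1 / (n : ℝ) ^ 2 * headSum b n := by
  simp only [headSum, Finset.sum_range_succ]

theorem headSum_le_pow (b n : ℕ) : headSum b n ≤ (n : ℝ) ^ b := by
  induction b generalizing n with
  | zero => simp [headSum]
  | succ b ih =>
    calc headSum (b + 1) n ≤ ∑ m ∈ range n, (n : ℝ) ^ b := by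
          refine Finset.sum_le_sum fun m hm => ?_
          rw [Finset.mem_range] at hm
          have h1 : 1 / (m : ℝ) ^ 2 ≤ 1 := by
            rcases Nat.eq_zero_or_pos m with rfl | h
            · simp
            · rw [div_le_one (by positivity)]
              exact one_le_pow₀ (by exact_mod_cast h)
          calc 1 / (m : ℝ) ^ 2 * headSum b m ≤ 1 * headSum b m :=
                mul_le_mul_of_nonneg_right h1 (headSum_nonneg b m)
            _ ≤ (m : ℝ) ^ b := by rw [one_mul]; exact ih m
            _ ≤ (n : ℝ) ^ b := by gcongr
      _ = (n : ℝ) ^ (b + 1) := by simp [pow_succ']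

theorem mzvBelow_replicate_two (b n : ℕ) :
    mzvBelow (List.replicate b 2) n = ENNReal.ofReal (headSum b n) := by
  induction b generalizing n with
  | zero => simp [mzvBelow_nil, headSum]
  | succ b ih =>
    rw [List.replicate_succ, mzvBelow_cons 2 two_ne_zero, headSum,
      ENNReal.ofReal_sum_of_nonneg fun m _ => mul_nonneg (by positivity) (headSum_nonneg b m),
      tsum_eq_sum (s := range n)]
    · refine Finset.sum_congr rfl fun m hm => ?_
      rw [if_pos (by exact_mod_cast Finset.mem_range.1 hm), ih, invPow,
        ENNReal.ofReal_mul (by positivity)]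
    · intro m hm
      exact if_neg fun h => hm (Finset.mem_range.2 (by exact_mod_cast h))

/-- The multiple zeta value of `ks` in which the outermost summation variable is weighted
by `t j`. -/
noncomputable def weightedMzv (t : ℕ → ℕ → ENNReal) (j : ℕ) : List ℕ → ENNReal
  | [] => t j 0
  | k :: ks => ∑' n : ℕ, t j n * (invPow k n * mzvBelow ks n)

theorem mzvBelow_top_eq_weightedMzv (t : ℕ → ℕ → ENNReal) (ht : ∀ n, t 0 n = 1)
    (ks : List ℕ) (hks : ∀ k ∈ ks, k ≠ 0) : mzvBelow ks ⊤ = weightedMzv t 0 ks := by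
  cases ks with
  | nil => simp [weightedMzv, mzvBelow_nil, ht]
  | cons k ks =>
    rw [mzvBelow_cons k (hks k (by simp)), weightedMzv]
    simp [ht]

theorem weightedMzv_two_cons (t : ℕ → ℕ → ENNReal)
    (ht : ∀ j n, t (j + 1) n = ∑' m : ℕ, if n < m then invPow 2 m * t j m else 0)
    (j : ℕ) (ks : List ℕ) (hks : ∀ k ∈ ks, k ≠ 0) :
    weightedMzv t j (2 :: ks) = weightedMzv t (j + 1) ks := by
  cases ks with
  | nil =>
    rw [weightedMzv, weightedMzv, ht]
    refine tsum_congr fun n => ?_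
    rcases Nat.eq_zero_or_pos n with rfl | hn
    · simp [invPow]
    · rw [if_pos hn, mzvBelow_nil, mul_one, mul_comm]
  | cons k ks =>
    rw [weightedMzv, weightedMzv]
    calc ∑' n : ℕ, t j n * (invPow 2 n * mzvBelow (k :: ks) n)
        = ∑' n : ℕ, ∑' m : ℕ,
            (if m < n then invPow 2 n * t j n else 0) * (invPow k m * mzvBelow ks m) := by
          refine tsum_congr fun n => ?_
          rw [mzvBelow_cons k (hks k (by simp)), ← ENNReal.tsum_mul_left, ← ENNReal.tsum_mul_left]
          refine tsum_congr fun m => ?_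
          by_cases h : m < n
          · simp only [Nat.cast_lt, h, if_true]; ring
          · simp only [Nat.cast_lt, h, if_false]; ring
      _ = ∑' m : ℕ, ∑' n : ℕ,
            (if m < n then invPow 2 n * t j n else 0) * (invPow k m * mzvBelow ks m) :=
          ENNReal.tsum_comm
      _ = _ := by
          refine tsum_congr fun m => ?_
          rw [ENNReal.tsum_mul_right, ht]

theorem weightedMzv_replicate_two_append (t : ℕ → ℕ → ENNReal)
    (ht : ∀ j n, t (j + 1) n = ∑' m : ℕ, if n < m then invPow 2 m * t j m else 0)
    (a j : ℕ) (ks : List ℕ) (hks : ∀ k ∈ ks, k ≠ 0) :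
    weightedMzv t j (List.replicate a 2 ++ ks) = weightedMzv t (j + a) ks := by
  induction a generalizing j with
  | zero => simp
  | succ a ih =>
    rw [List.replicate_succ, List.cons_append, weightedMzv_two_cons t ht, ih]
    · congr 1; ring
    · intro k hk
      rcases List.mem_append.1 hk with h | h
      · rw [List.eq_of_mem_replicate h]; norm_num
      · exact hks k h

/-! ### Sine moments and the tails of `ζ({2}^a)` -/

/-- The Wallis ratio `C(2n, n) / 4 ^ n`. -/
noncomputable def wallisRatio (n : ℕ) : ℝ := ∏ i ∈ range n, (2 * (i : ℝ) + 1) / (2 * i + 2)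

theorem wallisRatio_pos (n : ℕ) : 0 < wallisRatio n :=
  Finset.prod_pos fun i _ => by positivity

theorem wallisRatio_succ (n : ℕ) :
    wallisRatio (n + 1) = wallisRatio n * ((2 * (n : ℝ) + 1) / (2 * n + 2)) :=
  Finset.prod_range_succ _ _

theorem inv_wallisRatio_le (n : ℕ) : (wallisRatio n)⁻¹ ≤ (n : ℝ) + 1 := by
  induction n with
  | zero => simp [wallisRatio]
  | succ n ih =>
    rw [wallisRatio_succ, mul_inv, inv_div]
    calc (wallisRatio n)⁻¹ * ((2 * (n : ℝ) + 2) / (2 * n + 1))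
        ≤ ((n : ℝ) + 1) * ((2 * (n : ℝ) + 2) / (2 * n + 1)) := by gcongr
      _ ≤ ((n + 1 : ℕ) : ℝ) + 1 := by
        rw [← mul_div_assoc, div_le_iff₀ (by positivity)]
        push_cast
        nlinarith [Nat.cast_nonneg (α := ℝ) n]

/-- The divided power `(π - 2φ)^k / k!`. -/
noncomputable def piSubPow (k : ℕ) (φ : ℝ) : ℝ := (π - 2 * φ) ^ k / k.factorial

/-- The divided power `(2φ)^k / k!`. -/
noncomputable def twoMulPow (k : ℕ) (φ : ℝ) : ℝ := (2 * φ) ^ k / k.factorial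

theorem hasDerivAt_piSubPow (k : ℕ) (φ : ℝ) :
    HasDerivAt (piSubPow (k + 1)) (-2 * piSubPow k φ) φ := by
  have h := ((((hasDerivAt_id φ).const_mul 2).const_sub π).pow (k + 1)).div_const
    ((k + 1).factorial : ℝ)
  refine h.congr_deriv ?_
  have : (k.factorial : ℝ) ≠ 0 := by positivity
  simp only [piSubPow, Nat.factorial_succ, id, Nat.add_sub_cancel]
  push_cast
  field_simp

theorem hasDerivAt_twoMulPow (k : ℕ) (φ : ℝ) :
    HasDerivAt (twoMulPow (k + 1)) (2 * twoMulPow k φ) φ := by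
  have h := (((hasDerivAt_id φ).const_mul 2).pow (k + 1)).div_const ((k + 1).factorial : ℝ)
  refine h.congr_deriv ?_
  have : (k.factorial : ℝ) ≠ 0 := by positivity
  simp only [twoMulPow, Nat.factorial_succ, id, Nat.add_sub_cancel]
  push_cast
  field_simp

@[fun_prop]
theorem continuous_piSubPow (k : ℕ) : Continuous (piSubPow k) := by
  unfold piSubPow; fun_prop

@[fun_prop]
theorem continuous_twoMulPow (k : ℕ) : Continuous (twoMulPow k) := by
  unfold twoMulPow; fun_prop

theorem piSubPow_zero (φ : ℝ) : piSubPow 0 φ = 1 := by simp [piSubPow]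

theorem piSubPow_succ_pi_div_two (k : ℕ) : piSubPow (k + 1) (π / 2) = 0 := by
  rw [piSubPow, mul_div_cancel₀ π two_ne_zero]; simp

theorem piSubPow_nonneg {φ : ℝ} (hφ : φ ≤ π / 2) (k : ℕ) : 0 ≤ piSubPow k φ :=
  div_nonneg (pow_nonneg (by linarith) _) (by positivity)

theorem twoMulPow_nonneg {φ : ℝ} (hφ : 0 ≤ φ) (k : ℕ) : 0 ≤ twoMulPow k φ :=
  div_nonneg (pow_nonneg (by linarith) _) (by positivity)

/-- The moment `∫_0^{π/2} (π - 2φ)^{2a}/(2a)! sin^{2n} φ dφ`. -/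
noncomputable def sinMoment (a n : ℕ) : ℝ :=
  ∫ φ in (0 : ℝ)..π / 2, piSubPow (2 * a) φ * sin φ ^ (2 * n)

theorem sinMoment_nonneg (a n : ℕ) : 0 ≤ sinMoment a n := by
  refine intervalIntegral.integral_nonneg (by positivity) fun φ hφ => ?_
  rw [pow_mul (sin φ)]
  exact mul_nonneg (piSubPow_nonneg hφ.2 _) (by positivity)

theorem sinMoment_zero (n : ℕ) : sinMoment 0 n = π / 2 * wallisRatio n := by
  simp only [sinMoment, mul_zero, piSubPow_zero, one_mul]
  induction n with
  | zero => simp [wallisRatio]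
  | succ n ih =>
    rw [show 2 * (n + 1) = 2 * n + 2 by ring, integral_sin_pow, ih, wallisRatio_succ]
    simp only [sin_zero, cos_pi_div_two, mul_zero, sub_zero]
    push_cast
    simp
    ring

theorem sinMoment_succ (a n : ℕ) :
    (2 * (n : ℝ) + 2) * (2 * n + 1) * sinMoment (a + 1) n
      - (2 * (n : ℝ) + 2) ^ 2 * sinMoment (a + 1) (n + 1) = 4 * sinMoment a (n + 1) := by
  have hderiv : ∀ φ : ℝ, HasDerivAt
      (fun φ => piSubPow (2 * a + 1 + 1) φ * ((2 * (n : ℝ) + 2) * (sin φ ^ (2 * n + 1) * cos φ))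
        + 2 * (piSubPow (2 * a + 1) φ * sin φ ^ (2 * n + 2)))
      ((2 * (n : ℝ) + 2) * (2 * n + 1) * (piSubPow (2 * (a + 1)) φ * sin φ ^ (2 * n))
        - (2 * (n : ℝ) + 2) ^ 2 * (piSubPow (2 * (a + 1)) φ * sin φ ^ (2 * (n + 1)))
        - 4 * (piSubPow (2 * a) φ * sin φ ^ (2 * (n + 1)))) φ := by
    intro φ
    have h := ((hasDerivAt_piSubPow (2 * a + 1) φ).mul
      ((((hasDerivAt_sin φ).pow (2 * n + 1)).mul (hasDerivAt_cos φ)).const_mul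
        (2 * (n : ℝ) + 2))).add
      (((hasDerivAt_piSubPow (2 * a) φ).mul ((hasDerivAt_sin φ).pow (2 * n + 2))).const_mul 2)
    refine h.congr_deriv ?_
    have hc : cos φ ^ 2 = 1 - sin φ ^ 2 := by rw [← sin_sq_add_cos_sq φ]; ring
    simp only [Nat.add_sub_cancel, show 2 * (a + 1) = 2 * a + 1 + 1 by ring,
      show 2 * n + 2 - 1 = 2 * n + 1 by omega, Pi.pow_apply, Pi.mul_apply]
    push_cast
    linear_combination piSubPow (2 * a + 1 + 1) φ * (2 * (n : ℝ) + 2) * (2 * n + 1)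
      * sin φ ^ (2 * n) * hc
  have h := intervalIntegral.integral_eq_sub_of_hasDerivAt (a := 0) (b := π / 2)
    (fun φ _ => hderiv φ) (by apply Continuous.intervalIntegrable; fun_prop)
  rw [intervalIntegral.integral_sub (by apply Continuous.intervalIntegrable; fun_prop)
      (by apply Continuous.intervalIntegrable; fun_prop),
    intervalIntegral.integral_sub (by apply Continuous.intervalIntegrable; fun_prop)
      (by apply Continuous.intervalIntegrable; fun_prop)] at h
  simp only [intervalIntegral.integral_const_mul, piSubPow_succ_pi_div_two, sin_zero] at h
  simp only [sinMoment]
  simp at h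
  linarith

/-- The tail `∑_{m₁ > ⋯ > m_a > n} ∏ 1 / m_i ^ 2`, see `hasSum_tailSum`. -/
noncomputable def tailSum (a n : ℕ) : ℝ := 2 / π * sinMoment a n / wallisRatio n

theorem tailSum_nonneg (a n : ℕ) : 0 ≤ tailSum a n :=
  div_nonneg (mul_nonneg (by positivity) (sinMoment_nonneg a n)) (wallisRatio_pos n).le

theorem tailSum_zero (n : ℕ) : tailSum 0 n = 1 := by
  have := (wallisRatio_pos n).ne'
  have := pi_pos.ne'
  rw [tailSum, sinMoment_zero]
  field_simp

theorem tailSum_succ_sub (a n : ℕ) :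
    tailSum (a + 1) n - tailSum (a + 1) (n + 1)
      = 1 / ((n + 1 : ℕ) : ℝ) ^ 2 * tailSum a (n + 1) := by
  have h1 := (wallisRatio_pos n).ne'
  have h2 := pi_pos.ne'
  have h := sinMoment_succ a n
  have h3 : (n : ℝ) + 1 ≠ 0 := by positivity
  have h4 : 2 * (n : ℝ) + 1 ≠ 0 := by positivity
  have h5 : sinMoment a (n + 1) = ((2 * (n : ℝ) + 2) * (2 * n + 1) * sinMoment (a + 1) n
      - (2 * (n : ℝ) + 2) ^ 2 * sinMoment (a + 1) (n + 1)) / 4 := by rw [h]; ring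
  simp only [tailSum, wallisRatio_succ, h5]
  push_cast
  field_simp
  ring

theorem piSubPow_le {φ : ℝ} (h0 : 0 ≤ φ) (hφ : φ ≤ π / 2) (a : ℕ) :
    piSubPow (2 * (a + 1)) φ ≤ π ^ (2 * (a + 1)) * cos φ ^ 2 := by
  have h1 : π - 2 * φ ≤ π * cos φ := by
    have h := mul_le_sin (x := π / 2 - φ) (by linarith) (by linarith)
    rw [sin_pi_div_two_sub] at h
    have := mul_le_mul_of_nonneg_left h pi_pos.le
    calc π - 2 * φ = π * (2 / π * (π / 2 - φ)) := by field_simp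
      _ ≤ _ := this
  have hc : 0 ≤ cos φ := cos_nonneg_of_neg_pi_div_two_le_of_le (by linarith [pi_pos]) hφ
  have hf : (1 : ℝ) ≤ ((2 * (a + 1)).factorial : ℝ) := by
    exact_mod_cast Nat.factorial_pos _
  calc piSubPow (2 * (a + 1)) φ ≤ (π - 2 * φ) ^ (2 * (a + 1)) :=
        div_le_self (pow_nonneg (by linarith) _) hf
    _ ≤ (π * cos φ) ^ (2 * (a + 1)) := pow_le_pow_left₀ (by linarith) h1 _
    _ = π ^ (2 * (a + 1)) * (cos φ ^ 2 * (cos φ ^ 2) ^ a) := by ring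
    _ ≤ π ^ (2 * (a + 1)) * (cos φ ^ 2 * 1) := by
        gcongr
        exact pow_le_one₀ (by positivity) (cos_sq_le_one φ)
    _ = _ := by ring

theorem tailSum_succ_le (a n : ℕ) : tailSum (a + 1) n ≤ π ^ (2 * (a + 1)) * (1 / ((n : ℝ) + 1)) := by
  have hb : sinMoment (a + 1) n
      ≤ π ^ (2 * (a + 1)) * (π / 2 * (wallisRatio n - wallisRatio (n + 1))) := by
    rw [mul_sub, ← sinMoment_zero, ← sinMoment_zero, sinMoment, sinMoment, sinMoment,
      ← intervalIntegral.integral_sub (by apply Continuous.intervalIntegrable; fun_prop)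
        (by apply Continuous.intervalIntegrable; fun_prop),
      ← intervalIntegral.integral_const_mul]
    refine intervalIntegral.integral_mono_on (by positivity)
      (by apply Continuous.intervalIntegrable; fun_prop)
      (by apply Continuous.intervalIntegrable; fun_prop) fun φ hφ => ?_
    have h2 : 0 ≤ sin φ ^ (2 * n) := by rw [pow_mul]; positivity
    calc _ ≤ π ^ (2 * (a + 1)) * cos φ ^ 2 * sin φ ^ (2 * n) :=
          mul_le_mul_of_nonneg_right (piSubPow_le hφ.1 hφ.2 a) h2
      _ = _ := by
        rw [cos_sq']
        simp only [mul_zero, piSubPow_zero]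
        ring
  have hw := wallisRatio_pos n
  have h3 : (n : ℝ) + 1 ≠ 0 := by positivity
  calc tailSum (a + 1) n
      ≤ 2 / π * (π ^ (2 * (a + 1)) * (π / 2 * (wallisRatio n - wallisRatio (n + 1))))
        / wallisRatio n := by rw [tailSum]; gcongr
    _ = π ^ (2 * (a + 1)) * (1 / (2 * ((n : ℝ) + 1))) := by
      rw [wallisRatio_succ]
      field_simp
      ring
    _ ≤ _ := by
      gcongr
      linarith [Nat.cast_nonneg (α := ℝ) n]

theorem tendsto_tailSum_succ (a : ℕ) : Tendsto (tailSum (a + 1)) atTop (𝓝 0) := by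
  refine squeeze_zero (tailSum_nonneg _) (tailSum_succ_le a) ?_
  simpa using tendsto_one_div_add_atTop_nhds_zero_nat.const_mul (π ^ (2 * (a + 1)))

theorem hasSum_tailSum (a n : ℕ) :
    HasSum (fun k : ℕ => 1 / ((n + k + 1 : ℕ) : ℝ) ^ 2 * tailSum a (n + k + 1))
      (tailSum (a + 1) n) := by
  rw [hasSum_iff_tendsto_nat_of_nonneg
    fun k => mul_nonneg (by positivity) (tailSum_nonneg _ _)]
  have h : ∀ N, ∑ k ∈ range N, 1 / ((n + k + 1 : ℕ) : ℝ) ^ 2 * tailSum a (n + k + 1)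
      = tailSum (a + 1) n - tailSum (a + 1) (n + N) := by
    intro N
    induction N with
    | zero => simp
    | succ N ih =>
      rw [Finset.sum_range_succ, ih, ← tailSum_succ_sub, ← add_assoc]
      ring
  simp only [h]
  have := (tendsto_tailSum_succ a).comp (tendsto_add_atTop_nat n)
  simpa [Function.comp_def, add_comm] using this.const_sub (tailSum (a + 1) n)

theorem ofReal_tailSum_succ (a n : ℕ) : ENNReal.ofReal (tailSum (a + 1) n) =
    ∑' m : ℕ, if n < m then invPow 2 m * ENNReal.ofReal (tailSum a m) else 0 := by
  have h := hasSum_tailSum a n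
  rw [← h.tsum_eq, ENNReal.ofReal_tsum_of_nonneg
    (fun k => mul_nonneg (by positivity) (tailSum_nonneg _ _)) h.summable]
  have hinj : Function.Injective fun k : ℕ => n + k + 1 := fun i j hij => by
    simpa using hij
  rw [← hinj.tsum_eq
    (f := fun m : ℕ => if n < m then invPow 2 m * ENNReal.ofReal (tailSum a m) else 0)]
  · refine tsum_congr fun k => ?_
    rw [if_pos (by omega), invPow, ENNReal.ofReal_mul (by positivity)]
  · intro m hm
    have : n < m := by
      by_contra hlt
      exact hm (if_neg hlt)
    exact ⟨m - n - 1, show n + (m - n - 1) + 1 = m by omega⟩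

theorem tailSum_zero_right (a : ℕ) :
    tailSum a 0 = π ^ (2 * a) / (2 * a + 1).factorial := by
  have hd : ∀ φ, HasDerivAt (fun φ => -1 / 2 * piSubPow (2 * a + 1) φ)
      (piSubPow (2 * a) φ) φ := fun φ =>
    ((hasDerivAt_piSubPow (2 * a) φ).const_mul (-1 / 2)).congr_deriv (by ring)
  have h := intervalIntegral.integral_eq_sub_of_hasDerivAt (a := 0) (b := π / 2)
    (fun φ _ => hd φ) (by apply Continuous.intervalIntegrable; fun_prop)
  have h2 := pi_pos.ne'
  simp only [tailSum, sinMoment, mul_zero, pow_zero, mul_one, h, piSubPow_succ_pi_div_two]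
  simp only [piSubPow, wallisRatio, Finset.range_zero, Finset.prod_empty]
  field_simp
  ring

/-- Multiple zeta values of `{2}^m`. -/
theorem mzv_replicate_two (m : ℕ) :
    mzv (List.replicate m 2) = π ^ (2 * m) / (2 * m + 1).factorial := by
  have h := weightedMzv_replicate_two_append (fun j n => ENNReal.ofReal (tailSum j n))
    ofReal_tailSum_succ m 0 [] (by simp)
  rw [List.append_nil, ← mzvBelow_top_eq_weightedMzv _ (by simp [tailSum_zero])
    _ (fun k hk => by rw [List.eq_of_mem_replicate hk]; norm_num)] at h
  rw [mzv_eq_toReal, h, weightedMzv, ENNReal.toReal_ofReal (tailSum_nonneg _ _), zero_add,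
    tailSum_zero_right]

/-- Single zeta values. -/
theorem mzv_singleton (k : ℕ) (hk : k ≠ 0) : mzv [k] = ∑' n : ℕ, 1 / (n : ℝ) ^ k := by
  rw [mzv_eq_toReal, mzvBelow_cons k hk, ENNReal.tsum_toReal_eq]
  · refine tsum_congr fun n => ?_
    rw [if_pos (ENat.natCast_lt_top n), mzvBelow_nil, mul_one, invPow,
      ENNReal.toReal_ofReal (by positivity)]
  · intro n
    rw [if_pos (ENat.natCast_lt_top n), mzvBelow_nil, mul_one]
    exact ENNReal.ofReal_ne_top

/-- The value `ζ({2}^a, 3, {2}^b)` as a single series. -/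
theorem mzv_two_three_two (a b : ℕ) :
    mzv (List.replicate a 2 ++ 3 :: List.replicate b 2) =
      ∑' n : ℕ, tailSum a n * (1 / (n : ℝ) ^ 3 * headSum b n) := by
  have hne : ∀ k ∈ 3 :: List.replicate b 2, k ≠ 0 := by
    intro k hk
    rcases List.mem_cons.1 hk with rfl | h
    · norm_num
    · rw [List.eq_of_mem_replicate h]; norm_num
  have h := weightedMzv_replicate_two_append (fun j n => ENNReal.ofReal (tailSum j n))
    ofReal_tailSum_succ a 0 (3 :: List.replicate b 2) hne
  rw [← mzvBelow_top_eq_weightedMzv _ (by simp [tailSum_zero])] at h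
  · rw [mzv_eq_toReal, h, weightedMzv, zero_add, ENNReal.tsum_toReal_eq]
    · refine tsum_congr fun n => ?_
      rw [mzvBelow_replicate_two, invPow, ENNReal.toReal_mul, ENNReal.toReal_mul,
        ENNReal.toReal_ofReal (tailSum_nonneg _ _), ENNReal.toReal_ofReal (by positivity),
        ENNReal.toReal_ofReal (headSum_nonneg _ _)]
    · intro n
      rw [mzvBelow_replicate_two, invPow]
      exact ENNReal.mul_ne_top ENNReal.ofReal_ne_top
        (ENNReal.mul_ne_top ENNReal.ofReal_ne_top ENNReal.ofReal_ne_top)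
  · intro k hk
    rcases List.mem_append.1 hk with h | h
    · rw [List.eq_of_mem_replicate h]; norm_num
    · exact hne k h

/-! ### Power series of even powers of the inverse sine -/

theorem nonneg_of_hasDerivAt_nonneg {f f' : ℝ → ℝ} {c : ℝ} (hf : ∀ x, HasDerivAt f (f' x) x)
    (h0 : f 0 = 0) (hf' : ∀ x ∈ Set.Icc 0 c, 0 ≤ f' x) : ∀ x ∈ Set.Icc 0 c, 0 ≤ f x := by
  intro x hx
  have hmono : MonotoneOn f (Set.Icc 0 c) := by
    refine monotoneOn_of_deriv_nonneg (convex_Icc 0 c)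
      (fun y _ => (hf y).continuousAt.continuousWithinAt)
      (fun y _ => (hf y).differentiableAt.differentiableWithinAt) fun y hy => ?_
    rw [(hf y).deriv]
    exact hf' y (interior_subset hy)
  rw [← h0]
  exact hmono ⟨le_rfl, hx.1.trans hx.2⟩ hx hx.1

theorem nonneg_of_second_deriv_nonneg {f f' f'' : ℝ → ℝ} {c : ℝ}
    (hf : ∀ x, HasDerivAt f (f' x) x) (hf' : ∀ x, HasDerivAt f' (f'' x) x)
    (h0 : f 0 = 0) (h0' : f' 0 = 0) (h : ∀ x ∈ Set.Icc 0 c, 0 ≤ f'' x) :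
    ∀ x ∈ Set.Icc 0 c, 0 ≤ f x :=
  nonneg_of_hasDerivAt_nonneg hf h0 (nonneg_of_hasDerivAt_nonneg hf' h0' h)

theorem le_of_second_deriv_le {f f' f'' : ℝ → ℝ} {c δ : ℝ}
    (hf : ∀ x, HasDerivAt f (f' x) x) (hf' : ∀ x, HasDerivAt f' (f'' x) x)
    (h0 : f 0 = 0) (h0' : f' 0 = 0) (hδ : 0 ≤ δ) (h : ∀ x ∈ Set.Icc 0 c, f'' x ≤ 2 * δ) :
    ∀ x ∈ Set.Icc 0 c, f x ≤ δ * c ^ 2 := by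
  intro x hx
  have h1 : 0 ≤ δ * x ^ 2 - f x := by
    refine nonneg_of_second_deriv_nonneg (f := fun x => δ * x ^ 2 - f x)
      (f' := fun x => 2 * δ * x - f' x) (f'' := fun x => 2 * δ - f'' x) (c := c) ?_ ?_ ?_ ?_ ?_ x hx
    · exact fun y => ((((hasDerivAt_id y).pow 2).const_mul δ).sub (hf y)).congr_deriv
        (by simp; ring)
    · exact fun y => (((hasDerivAt_id y).const_mul (2 * δ)).sub (hf' y)).congr_deriv (by simp)
    · simp [h0]
    · simp [h0']
    · exact fun y hy => sub_nonneg.2 (h y hy)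
  have h2 : x ^ 2 ≤ c ^ 2 := pow_le_pow_left₀ hx.1 hx.2 2
  nlinarith [mul_le_mul_of_nonneg_left h2 hδ]

/-- The coefficients in the expansion of `(2φ)^{2b+2}/(2b+2)!` in powers of `sin² φ`. -/
noncomputable def arcsinCoeff (b n : ℕ) : ℝ :=
  headSum b (n + 1) / (((n : ℝ) + 1) ^ 2 * wallisRatio (n + 1))

theorem arcsinCoeff_nonneg (b n : ℕ) : 0 ≤ arcsinCoeff b n :=
  div_nonneg (headSum_nonneg _ _) (mul_nonneg (by positivity) (wallisRatio_pos _).le)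

/-- The remainder in the expansion of `(2φ)^{2b+2}/(2b+2)!` in powers of `sin² φ`. -/
noncomputable def arcsinRem (b N : ℕ) (φ : ℝ) : ℝ :=
  twoMulPow (2 * b + 2) φ - ∑ n ∈ range N, arcsinCoeff b n * sin φ ^ (2 * (n + 1))

/-- The derivative of `arcsinRem`. -/
noncomputable def arcsinRemDeriv (b N : ℕ) (φ : ℝ) : ℝ :=
  2 * twoMulPow (2 * b + 1) φ -
    ∑ n ∈ range N, arcsinCoeff b n * ((2 * (n : ℝ) + 2) * (sin φ ^ (2 * n + 1) * cos φ))

/-- The normalised even power `sin^{2n} φ · 4^n / C(2n, n)`. -/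
noncomputable def normSinPow (n : ℕ) (φ : ℝ) : ℝ := sin φ ^ (2 * n) / wallisRatio n

theorem hasDerivAt_arcsinRem (b N : ℕ) (φ : ℝ) :
    HasDerivAt (arcsinRem b N) (arcsinRemDeriv b N φ) φ := by
  refine (hasDerivAt_twoMulPow (2 * b + 1) φ).sub (HasDerivAt.fun_sum fun n _ => ?_)
  refine (((hasDerivAt_sin φ).pow (2 * (n + 1))).const_mul _).congr_deriv ?_
  rw [show 2 * (n + 1) - 1 = 2 * n + 1 by omega]
  push_cast
  ring

theorem hasDerivAt_arcsinRemDeriv (b N : ℕ) (φ : ℝ) :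
    HasDerivAt (arcsinRemDeriv b N) (4 * (twoMulPow (2 * b) φ -
      ∑ n ∈ range N, headSum b (n + 1) * (normSinPow n φ - normSinPow (n + 1) φ))) φ := by
  have h1 := (hasDerivAt_twoMulPow (2 * b) φ).const_mul 2
  have h2 : HasDerivAt (fun φ => ∑ n ∈ range N,
      arcsinCoeff b n * ((2 * (n : ℝ) + 2) * (sin φ ^ (2 * n + 1) * cos φ)))
      (∑ n ∈ range N, 4 * (headSum b (n + 1) * (normSinPow n φ - normSinPow (n + 1) φ))) φ := by
    refine HasDerivAt.fun_sum fun n _ => ?_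
    refine (((((hasDerivAt_sin φ).pow (2 * n + 1)).mul (hasDerivAt_cos φ)).const_mul
        (2 * (n : ℝ) + 2)).const_mul _).congr_deriv ?_
    have hc : cos φ ^ 2 = 1 - sin φ ^ 2 := by rw [← sin_sq_add_cos_sq φ]; ring
    have hw := (wallisRatio_pos n).ne'
    have h3 : (n : ℝ) + 1 ≠ 0 := by positivity
    have h4 : 2 * (n : ℝ) + 1 ≠ 0 := by positivity
    have e : ((2 * n + 1 : ℕ) : ℝ) * sin φ ^ (2 * n) * cos φ * cos φ
        = ((2 * n + 1 : ℕ) : ℝ) * sin φ ^ (2 * n) * (1 - sin φ ^ 2) := by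
      rw [← hc]; ring
    simp only [Nat.add_sub_cancel, Pi.pow_apply, e, arcsinCoeff, normSinPow, wallisRatio_succ]
    push_cast
    field_simp
    ring
  refine (h1.sub h2).congr_deriv ?_
  rw [← Finset.mul_sum]
  ring

theorem sum_headSum_zero_mul (N : ℕ) (φ : ℝ) :
    ∑ n ∈ range N, headSum 0 (n + 1) * (normSinPow n φ - normSinPow (n + 1) φ)
      = 1 - headSum 0 (N + 1) * normSinPow N φ := by
  simp only [headSum, one_mul, Finset.sum_range_sub' (fun n => normSinPow n φ)]
  simp [normSinPow, wallisRatio]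

theorem sum_headSum_succ_mul (b N : ℕ) (φ : ℝ) :
    ∑ n ∈ range N, headSum (b + 1) (n + 1) * (normSinPow n φ - normSinPow (n + 1) φ)
      = ∑ n ∈ range N, arcsinCoeff b n * sin φ ^ (2 * (n + 1))
        - headSum (b + 1) (N + 1) * normSinPow N φ := by
  induction N with
  | zero => simp [headSum]
  | succ N ih =>
    rw [Finset.sum_range_succ, ih, Finset.sum_range_succ, headSum_succ_succ b (N + 1)]
    have : arcsinCoeff b N * sin φ ^ (2 * (N + 1))
        = 1 / ((N + 1 : ℕ) : ℝ) ^ 2 * headSum b (N + 1) * normSinPow (N + 1) φ := by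
      rw [arcsinCoeff, normSinPow]
      push_cast
      field_simp
    rw [this]
    ring

theorem hasDerivAt_arcsinRemDeriv_zero (N : ℕ) (φ : ℝ) :
    HasDerivAt (arcsinRemDeriv 0 N) (4 * (headSum 0 (N + 1) * normSinPow N φ)) φ := by
  refine (hasDerivAt_arcsinRemDeriv 0 N φ).congr_deriv ?_
  rw [sum_headSum_zero_mul]
  simp [twoMulPow]

theorem hasDerivAt_arcsinRemDeriv_succ (b N : ℕ) (φ : ℝ) :
    HasDerivAt (arcsinRemDeriv (b + 1) N)
      (4 * (arcsinRem b N φ + headSum (b + 1) (N + 1) * normSinPow N φ)) φ := by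
  refine (hasDerivAt_arcsinRemDeriv (b + 1) N φ).congr_deriv ?_
  rw [sum_headSum_succ_mul, arcsinRem, show 2 * (b + 1) = 2 * b + 2 by ring]
  ring

theorem arcsinRem_zero (b N : ℕ) : arcsinRem b N 0 = 0 := by
  simp [arcsinRem, twoMulPow]

theorem arcsinRemDeriv_zero (b N : ℕ) : arcsinRemDeriv b N 0 = 0 := by
  simp [arcsinRemDeriv, twoMulPow]

theorem headSum_mul_normSinPow_nonneg (b N : ℕ) (φ : ℝ) :
    0 ≤ headSum b (N + 1) * normSinPow N φ := by
  rw [normSinPow, pow_mul]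
  exact mul_nonneg (headSum_nonneg _ _) (div_nonneg (by positivity) (wallisRatio_pos _).le)

theorem arcsinRem_nonneg (b N : ℕ) {φ : ℝ} (hφ : 0 ≤ φ) : 0 ≤ arcsinRem b N φ := by
  induction b generalizing φ with
  | zero =>
    exact nonneg_of_second_deriv_nonneg (hasDerivAt_arcsinRem 0 N)
      (hasDerivAt_arcsinRemDeriv_zero N) (arcsinRem_zero _ _) (arcsinRemDeriv_zero _ _)
      (fun x _ => mul_nonneg (by norm_num) (headSum_mul_normSinPow_nonneg _ _ _)) φ ⟨hφ, le_rfl⟩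
  | succ b ih =>
    exact nonneg_of_second_deriv_nonneg (hasDerivAt_arcsinRem (b + 1) N)
      (hasDerivAt_arcsinRemDeriv_succ b N) (arcsinRem_zero _ _) (arcsinRemDeriv_zero _ _)
      (fun x hx => mul_nonneg (by norm_num)
        (add_nonneg (ih hx.1) (headSum_mul_normSinPow_nonneg _ _ _))) φ ⟨hφ, le_rfl⟩

theorem headSum_mul_normSinPow_le (b N : ℕ) {c x : ℝ} (hc : c ≤ π / 2)
    (hx : x ∈ Set.Icc 0 c) :
    headSum b (N + 1) * normSinPow N x ≤ ((N + 1 : ℕ) : ℝ) ^ (b + 1) * (sin c ^ 2) ^ N := by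
  have h0 : 0 ≤ sin x := sin_nonneg_of_nonneg_of_le_pi hx.1 (by linarith [hx.2, pi_pos])
  have h1 : sin x ≤ sin c :=
    sin_le_sin_of_le_of_le_pi_div_two (by linarith [hx.1, pi_pos]) hc hx.2
  have h2 : (sin x ^ 2) ^ N ≤ (sin c ^ 2) ^ N := by gcongr
  calc headSum b (N + 1) * normSinPow N x
      = headSum b (N + 1) * ((wallisRatio N)⁻¹ * (sin x ^ 2) ^ N) := by
        rw [normSinPow, pow_mul]; ring
    _ ≤ ((N + 1 : ℕ) : ℝ) ^ b * (((N : ℝ) + 1) * (sin c ^ 2) ^ N) := by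
        have := (wallisRatio_pos N).le
        gcongr
        · exact headSum_le_pow b (N + 1)
        · exact inv_wallisRatio_le N
    _ = _ := by push_cast; ring

theorem tendsto_succ_pow_mul_pow (k : ℕ) {q : ℝ} (h0 : 0 < q) (h1 : q < 1) :
    Tendsto (fun N : ℕ => ((N + 1 : ℕ) : ℝ) ^ k * q ^ N) atTop (𝓝 0) := by
  have h := (tendsto_pow_const_mul_const_pow_of_abs_lt_one k
    (by rwa [abs_of_pos h0] : |q| < 1)).comp (tendsto_add_atTop_nat 1)
  have h2 := h.mul_const q⁻¹
  rw [zero_mul] at h2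
  refine h2.congr fun N => ?_
  simp only [Function.comp_apply, pow_succ q]
  field_simp

theorem exists_bound_arcsinRem (b : ℕ) {c : ℝ} (hc0 : 0 < c) (hc : c < π / 2) :
    ∃ B : ℕ → ℝ, Tendsto B atTop (𝓝 0) ∧ ∀ N, ∀ x ∈ Set.Icc 0 c, arcsinRem b N x ≤ B N := by
  have hs0 : 0 < sin c := sin_pos_of_pos_of_lt_pi hc0 (by linarith)
  have hs1 : sin c ^ 2 < 1 := by
    have : 0 < cos c := cos_pos_of_mem_Ioo ⟨by linarith, hc⟩
    nlinarith [sin_sq_add_cos_sq c]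
  induction b with
  | zero =>
    refine ⟨fun N => 2 * (((N + 1 : ℕ) : ℝ) ^ (0 + 1) * (sin c ^ 2) ^ N) * c ^ 2, ?_, ?_⟩
    · simpa using ((tendsto_succ_pow_mul_pow 1 (by positivity) hs1).const_mul 2).mul_const (c ^ 2)
    · intro N
      refine le_of_second_deriv_le (hasDerivAt_arcsinRem 0 N) (hasDerivAt_arcsinRemDeriv_zero N)
        (arcsinRem_zero _ _) (arcsinRemDeriv_zero _ _) (by positivity) fun x hx => ?_
      linarith [headSum_mul_normSinPow_le 0 N hc.le hx]
  | succ b ih =>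
    obtain ⟨B, hB, hle⟩ := ih
    refine ⟨fun N => 2 * (B N + ((N + 1 : ℕ) : ℝ) ^ (b + 1 + 1) * (sin c ^ 2) ^ N) * c ^ 2, ?_, ?_⟩
    · simpa using ((hB.add (tendsto_succ_pow_mul_pow (b + 1 + 1) (by positivity) hs1)).const_mul
        2).mul_const (c ^ 2)
    · intro N
      have hBN : 0 ≤ B N := (arcsinRem_nonneg b N hc0.le).trans (hle N c ⟨hc0.le, le_rfl⟩)
      refine le_of_second_deriv_le (hasDerivAt_arcsinRem (b + 1) N)
        (hasDerivAt_arcsinRemDeriv_succ b N)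
        (arcsinRem_zero _ _) (arcsinRemDeriv_zero _ _) (by positivity) fun x hx => ?_
      linarith [headSum_mul_normSinPow_le (b + 1) N hc.le hx, hle N x hx]

theorem tendsto_arcsinRem (b : ℕ) {c : ℝ} (hc0 : 0 < c) (hc : c < π / 2) :
    Tendsto (fun N => arcsinRem b N c) atTop (𝓝 0) := by
  obtain ⟨B, hB, hle⟩ := exists_bound_arcsinRem b hc0 hc
  exact squeeze_zero (fun N => arcsinRem_nonneg b N hc0.le)
    (fun N => hle N c ⟨hc0.le, le_rfl⟩) hB

theorem tendsto_sum_arcsinCoeff (b : ℕ) {c : ℝ} (hc0 : 0 < c) (hc : c < π / 2) :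
    Tendsto (fun N => ∑ n ∈ range N, arcsinCoeff b n * sin c ^ (2 * (n + 1))) atTop
      (𝓝 (twoMulPow (2 * b + 2) c)) := by
  have := (tendsto_arcsinRem b hc0 hc).const_sub (twoMulPow (2 * b + 2) c)
  simpa [arcsinRem] using this

/-! ### The cotangent integral -/

/-- The polynomial `(π - 2φ)^{2a+1}/(2a+1)! · (2φ)^{2b+2}/(2b+2)!`. -/
noncomputable def cotWeight (a b : ℕ) (φ : ℝ) : ℝ :=
  piSubPow (2 * a + 1) φ * twoMulPow (2 * b + 2) φ

@[fun_prop]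
theorem continuous_cotWeight (a b : ℕ) : Continuous (cotWeight a b) := by
  unfold cotWeight; fun_prop

theorem integral_piSubPow_mul_sin_pow_mul_cos (a n : ℕ) :
    ∫ φ in (0 : ℝ)..π / 2, piSubPow (2 * a + 1) φ * (sin φ ^ (2 * n + 1) * cos φ)
      = sinMoment a (n + 1) / ((n : ℝ) + 1) := by
  have hd : ∀ φ : ℝ, HasDerivAt
      (fun φ => piSubPow (2 * a + 1) φ * sin φ ^ (2 * n + 2))
      ((2 * (n : ℝ) + 2) * (piSubPow (2 * a + 1) φ * (sin φ ^ (2 * n + 1) * cos φ))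
        - 2 * (piSubPow (2 * a) φ * sin φ ^ (2 * (n + 1)))) φ := by
    intro φ
    refine ((hasDerivAt_piSubPow (2 * a) φ).mul ((hasDerivAt_sin φ).pow (2 * n + 2))).congr_deriv ?_
    simp only [show 2 * n + 2 - 1 = 2 * n + 1 by omega, Pi.pow_apply]
    push_cast
    ring
  have h := intervalIntegral.integral_eq_sub_of_hasDerivAt (a := 0) (b := π / 2)
    (fun φ _ => hd φ) (by apply Continuous.intervalIntegrable; fun_prop)
  rw [intervalIntegral.integral_sub (by apply Continuous.intervalIntegrable; fun_prop)
      (by apply Continuous.intervalIntegrable; fun_prop)] at h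
  simp only [intervalIntegral.integral_const_mul, piSubPow_succ_pi_div_two, sin_zero] at h
  rw [eq_div_iff (by positivity), sinMoment]
  simp at h
  linarith

theorem tailSum_mul_eq (a b n : ℕ) :
    tailSum a (n + 1) * (1 / ((n + 1 : ℕ) : ℝ) ^ 3 * headSum b (n + 1))
      = 2 / π * (arcsinCoeff b n * (sinMoment a (n + 1) / ((n : ℝ) + 1))) := by
  rw [tailSum, arcsinCoeff]
  have := (wallisRatio_pos (n + 1)).ne'
  have h3 : (n : ℝ) + 1 ≠ 0 := by positivity
  push_cast
  field_simp

theorem cotWeight_div_sin_le (a b : ℕ) {φ : ℝ} (h0 : 0 < φ) (hφ : φ ≤ π / 2) :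
    cotWeight a b φ / sin φ
      ≤ π ^ (2 * a + 1) * (π * π ^ (2 * b + 1)) := by
  have hs : 0 < sin φ := sin_pos_of_pos_of_lt_pi h0 (by linarith [pi_pos])
  have h1 : 2 * φ ≤ π * sin φ := by
    have h := mul_le_mul_of_nonneg_left (mul_le_sin h0.le hφ) pi_pos.le
    calc 2 * φ = π * (2 / π * φ) := by field_simp
      _ ≤ _ := h
  have hf (k : ℕ) : (1 : ℝ) ≤ (k.factorial : ℝ) := by
    exact_mod_cast Nat.factorial_pos _
  rw [div_le_iff₀ hs]
  calc cotWeight a b φ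
      ≤ (π - 2 * φ) ^ (2 * a + 1) * (2 * φ) ^ (2 * b + 2) :=
        mul_le_mul (div_le_self (pow_nonneg (by linarith) _) (hf _))
          (div_le_self (by positivity) (hf _)) (twoMulPow_nonneg h0.le _)
          (pow_nonneg (by linarith) _)
    _ = (π - 2 * φ) ^ (2 * a + 1) * ((2 * φ) * (2 * φ) ^ (2 * b + 1)) := by ring
    _ ≤ π ^ (2 * a + 1) * ((π * sin φ) * π ^ (2 * b + 1)) := by
        have : 0 ≤ π - 2 * φ := by linarith
        gcongr <;> linarith
    _ = _ := by ring

theorem tendsto_sum_cotIntegral (a b : ℕ) :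
    Tendsto (fun N => ∑ n ∈ range N, arcsinCoeff b n * (sinMoment a (n + 1) / ((n : ℝ) + 1)))
      atTop (𝓝 (∫ φ in (0 : ℝ)..π / 2, cos φ * (cotWeight a b φ / sin φ))) := by
  have hpi : (0 : ℝ) ≤ π / 2 := by positivity
  have hsum : ∀ N, ∑ n ∈ range N, arcsinCoeff b n * (sinMoment a (n + 1) / ((n : ℝ) + 1))
      = ∫ φ in (0 : ℝ)..π / 2, ∑ n ∈ range N,
        arcsinCoeff b n * (piSubPow (2 * a + 1) φ * (sin φ ^ (2 * n + 1) * cos φ)) := by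
    intro N
    rw [intervalIntegral.integral_finsetSum
      fun n _ => by apply Continuous.intervalIntegrable; fun_prop]
    simp only [intervalIntegral.integral_const_mul, integral_piSubPow_mul_sin_pow_mul_cos]
  have hfac : ∀ N φ, sin φ ≠ 0 → ∑ n ∈ range N,
        arcsinCoeff b n * (piSubPow (2 * a + 1) φ * (sin φ ^ (2 * n + 1) * cos φ))
      = cos φ * (piSubPow (2 * a + 1) φ
        * (∑ n ∈ range N, arcsinCoeff b n * sin φ ^ (2 * (n + 1))) / sin φ) := by
    intro N φ hs
    rw [Finset.mul_sum, Finset.sum_div, Finset.mul_sum]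
    refine Finset.sum_congr rfl fun n _ => ?_
    field_simp
    ring
  simp only [hsum]
  refine intervalIntegral.tendsto_integral_filter_of_dominated_convergence
    (fun _ => π ^ (2 * a + 1) * (π * π ^ (2 * b + 1))) ?_ ?_ ?_ ?_
  · refine Eventually.of_forall fun N => Continuous.aestronglyMeasurable ?_
    fun_prop
  · refine Eventually.of_forall fun N => Eventually.of_forall fun φ hφ => ?_
    rw [Set.uIoc_of_le hpi] at hφ
    have hs : 0 < sin φ := sin_pos_of_pos_of_lt_pi hφ.1 (by linarith [pi_pos, hφ.2])
    have hc0 : 0 ≤ cos φ :=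
      cos_nonneg_of_neg_pi_div_two_le_of_le (by linarith [hφ.1, pi_pos]) hφ.2
    have hp := piSubPow_nonneg hφ.2 (2 * a + 1)
    have hS : 0 ≤ ∑ n ∈ range N, arcsinCoeff b n * sin φ ^ (2 * (n + 1)) :=
      Finset.sum_nonneg fun n _ => mul_nonneg (arcsinCoeff_nonneg _ _) (by positivity)
    have hle : ∑ n ∈ range N, arcsinCoeff b n * sin φ ^ (2 * (n + 1))
        ≤ twoMulPow (2 * b + 2) φ := sub_nonneg.1 (arcsinRem_nonneg b N hφ.1.le)
    rw [hfac N φ hs.ne', Real.norm_of_nonneg (by positivity)]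
    refine le_trans (mul_le_of_le_one_left (by positivity) (cos_le_one φ)) ?_
    refine le_trans ?_ (cotWeight_div_sin_le a b hφ.1 hφ.2)
    rw [cotWeight]
    gcongr
  · exact intervalIntegrable_const
  · have hne : ∀ᵐ φ : ℝ, φ ≠ π / 2 := by
      simp [MeasureTheory.ae_iff]
    filter_upwards [hne] with φ hφne hφ
    rw [Set.uIoc_of_le hpi] at hφ
    have hs : 0 < sin φ := sin_pos_of_pos_of_lt_pi hφ.1 (by linarith [pi_pos, hφ.2])
    simp only [hfac _ φ hs.ne']
    exact (((tendsto_sum_arcsinCoeff b hφ.1 (lt_of_le_of_ne hφ.2 hφne)).const_mul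
      (piSubPow (2 * a + 1) φ)).div_const (sin φ)).const_mul (cos φ)

/-- The value `ζ({2}^a, 3, {2}^b)` as a cotangent integral. -/
theorem mzv_eq_cotIntegral (a b : ℕ) :
    mzv (List.replicate a 2 ++ 3 :: List.replicate b 2) =
      2 / π * ∫ φ in (0 : ℝ)..π / 2, cos φ * (cotWeight a b φ / sin φ) := by
  rw [mzv_two_three_two]
  refine HasSum.tsum_eq ?_
  rw [← hasSum_nat_add_iff' 1]
  simp only [Finset.sum_range_one, Nat.cast_zero]
  rw [hasSum_iff_tendsto_nat_of_nonneg]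
  · simp only [tailSum_mul_eq, ← Finset.mul_sum]
    simpa using (tendsto_sum_cotIntegral a b).const_mul (2 / π)
  · exact fun n => mul_nonneg (tailSum_nonneg _ _)
      (mul_nonneg (by positivity) (headSum_nonneg _ _))

theorem cos_eq_sin_mul_sum_add (N : ℕ) (φ : ℝ) :
    cos φ = sin φ * ∑ k ∈ range N, 2 * sin (2 * ((k : ℝ) + 1) * φ) + cos ((2 * N + 1) * φ) := by
  induction N with
  | zero => simp
  | succ N ih =>
    have h1 : cos ((2 * (N : ℝ) + 1) * φ) =
        cos (2 * ((N : ℝ) + 1) * φ) * cos φ + sin (2 * ((N : ℝ) + 1) * φ) * sin φ := by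
      rw [← cos_sub]; ring_nf
    have h2 : cos ((2 * ((N + 1 : ℕ) : ℝ) + 1) * φ) =
        cos (2 * ((N : ℝ) + 1) * φ) * cos φ - sin (2 * ((N : ℝ) + 1) * φ) * sin φ := by
      rw [← cos_add]; push_cast; ring_nf
    rw [Finset.sum_range_succ, h2]
    linear_combination ih + h1

/-- A form of the Riemann–Lebesgue lemma. -/
theorem tendsto_integral_cos_mul {f : ℝ → ℝ} {c : ℝ} (hc : 0 ≤ c)
    (hf : IntervalIntegrable f MeasureTheory.volume 0 c) :
    Tendsto (fun N : ℕ => ∫ φ in (0 : ℝ)..c, cos ((2 * N + 1) * φ) * f φ) atTop (𝓝 0) := by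
  rw [intervalIntegrable_iff_integrableOn_Ioc_of_le hc] at hf
  set g : ℝ → ℂ := fun φ => (((Set.Ioc 0 c).indicator f φ : ℝ) : ℂ) with hg
  have hgi : MeasureTheory.Integrable g :=
    ((MeasureTheory.integrable_indicator_iff measurableSet_Ioc).2 hf).ofReal
  have hw : Tendsto (fun N : ℕ => (2 * (N : ℝ) + 1) / (2 * π)) atTop (cocompact ℝ) := by
    refine Tendsto.mono_right ?_ atTop_le_cocompact
    refine Tendsto.atTop_div_const (by positivity) ?_
    exact tendsto_atTop_add_const_right _ _
      (tendsto_natCast_atTop_atTop.const_mul_atTop two_pos)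
  have h := (Real.tendsto_integral_exp_smul_cocompact g).comp hw
  have h2 := (Complex.continuous_re.tendsto _).comp h
  rw [Complex.zero_re] at h2
  refine h2.congr fun N => ?_
  simp only [Function.comp_apply]
  have hfint : MeasureTheory.Integrable
      (fun v => Real.fourierChar (-(v * ((2 * (N : ℝ) + 1) / (2 * π)))) • g v) := by
    have := (Real.fourierIntegral_convergent_iff ((2 * (N : ℝ) + 1) / (2 * π)) (f := g)).2 hgi
    simpa [mul_comm] using this
  rw [intervalIntegral.integral_of_le hc, ← MeasureTheory.integral_indicator measurableSet_Ioc]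
  refine Eq.trans (integral_re hfint).symm ?_
  refine MeasureTheory.integral_congr_ae (Eventually.of_forall fun v => ?_)
  simp only [hg, Circle.smul_def, Real.fourierChar_apply, smul_eq_mul]
  have he : 2 * π * -(v * ((2 * (N : ℝ) + 1) / (2 * π))) = -((2 * N + 1) * v) := by
    field_simp
  rw [he]
  by_cases hv : v ∈ Set.Ioc 0 c
  · simp only [Set.indicator_of_mem hv]
    simp [Complex.exp_re, -Complex.ofReal_neg]
  · simp [Set.indicator_of_notMem hv]

theorem intervalIntegrable_cotWeight_div_sin (a b : ℕ) :
    IntervalIntegrable (fun φ => cotWeight a b φ / sin φ) MeasureTheory.volume 0 (π / 2) := by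
  have hpi : (0 : ℝ) ≤ π / 2 := by positivity
  refine IntervalIntegrable.mono_fun'
    (g := fun _ => π ^ (2 * a + 1) * (π * π ^ (2 * b + 1))) intervalIntegrable_const ?_ ?_
  · exact ((continuous_cotWeight a b).measurable.div continuous_sin.measurable).aestronglyMeasurable
  · refine (MeasureTheory.ae_restrict_iff' measurableSet_uIoc).2 (Eventually.of_forall fun φ hφ => ?_)
    rw [Set.uIoc_of_le hpi] at hφ
    have hs : 0 < sin φ := sin_pos_of_pos_of_lt_pi hφ.1 (by linarith [pi_pos, hφ.2])
    change ‖cotWeight a b φ / sin φ‖ ≤ _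
    rw [Real.norm_of_nonneg]
    · exact cotWeight_div_sin_le a b hφ.1 hφ.2
    · exact div_nonneg (mul_nonneg (piSubPow_nonneg hφ.2 _) (twoMulPow_nonneg hφ.1.le _)) hs.le

theorem tendsto_sum_integral_sin (a b : ℕ) :
    Tendsto (fun N => ∑ k ∈ range N,
        ∫ φ in (0 : ℝ)..π / 2, 2 * (cotWeight a b φ * sin (2 * ((k : ℝ) + 1) * φ))) atTop
      (𝓝 (∫ φ in (0 : ℝ)..π / 2, cos φ * (cotWeight a b φ / sin φ))) := by
  have hpi : (0 : ℝ) ≤ π / 2 := by positivity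
  have hfint := intervalIntegrable_cotWeight_div_sin a b
  have hlim := (tendsto_integral_cos_mul hpi hfint).const_sub
    (∫ φ in (0 : ℝ)..π / 2, cos φ * (cotWeight a b φ / sin φ))
  rw [sub_zero] at hlim
  refine hlim.congr fun N => ?_
  rw [← intervalIntegral.integral_sub (hfint.continuousOn_mul (by fun_prop))
      (hfint.continuousOn_mul (by fun_prop)),
    ← intervalIntegral.integral_finsetSum
      fun n _ => by apply Continuous.intervalIntegrable; fun_prop]
  refine intervalIntegral.integral_congr_ae (Eventually.of_forall fun φ hφ => ?_)
  rw [Set.uIoc_of_le hpi] at hφ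
  have hs : sin φ ≠ 0 := (sin_pos_of_pos_of_lt_pi hφ.1 (by linarith [pi_pos, hφ.2])).ne'
  have h := cos_eq_sin_mul_sum_add N φ
  have h2 : ∑ k ∈ range N, 2 * (cotWeight a b φ * sin (2 * ((k : ℝ) + 1) * φ))
      = cotWeight a b φ * ∑ k ∈ range N, 2 * sin (2 * ((k : ℝ) + 1) * φ) := by
    rw [Finset.mul_sum]
    exact Finset.sum_congr rfl fun k _ => by ring
  rw [h2, ← sub_mul, sub_eq_of_eq_add h, mul_comm (sin φ), mul_assoc,
    mul_div_cancel₀ _ hs, mul_comm]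

/-! ### Integrals of polynomials against sines -/

open Polynomial in
theorem integral_polynomial_mul_sin_step (p : ℝ[X]) (k : ℕ) (hk : k ≠ 0) :
    ∫ θ in (0 : ℝ)..π, p.eval θ * sin (k * θ)
      = 1 / (k : ℝ) * (p.eval 0 - (-1) ^ k * p.eval π)
        - 1 / (k : ℝ) ^ 2 *
          ∫ θ in (0 : ℝ)..π, (derivative (derivative p)).eval θ * sin (k * θ) := by
  have hk' : (k : ℝ) ≠ 0 := Nat.cast_ne_zero.2 hk
  have hd : ∀ θ : ℝ, HasDerivAt
      (fun θ => 1 / (k : ℝ) ^ 2 * ((derivative p).eval θ * sin (k * θ))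
        - 1 / (k : ℝ) * (p.eval θ * cos (k * θ)))
      (p.eval θ * sin (k * θ)
        + 1 / (k : ℝ) ^ 2 * ((derivative (derivative p)).eval θ * sin (k * θ))) θ := by
    intro θ
    have hl : HasDerivAt (fun θ : ℝ => (k : ℝ) * θ) k θ := by
      simpa using (hasDerivAt_id θ).const_mul (k : ℝ)
    refine ((((derivative p).hasDerivAt θ).mul hl.sin).const_mul _ |>.sub
      (((p.hasDerivAt θ).mul hl.cos).const_mul _)).congr_deriv ?_
    field_simp
    ring
  have h := intervalIntegral.integral_eq_sub_of_hasDerivAt (a := 0) (b := π)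
    (fun θ _ => hd θ) (by apply Continuous.intervalIntegrable; fun_prop)
  rw [intervalIntegral.integral_add (by apply Continuous.intervalIntegrable; fun_prop)
      (by apply Continuous.intervalIntegrable; fun_prop),
    intervalIntegral.integral_const_mul] at h
  rw [eq_sub_iff_add_eq, h, sin_nat_mul_pi, cos_nat_mul_pi]
  simp
  ring

open Polynomial in
theorem integral_polynomial_mul_sin (p : ℝ[X]) (k : ℕ) (hk : k ≠ 0) (m : ℕ) :
    ∫ θ in (0 : ℝ)..π, p.eval θ * sin (k * θ)
      = ∑ r ∈ range m, (-1) ^ r * (1 / (k : ℝ) ^ (2 * r + 1)) *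
          ((derivative^[2 * r] p).eval 0 - (-1) ^ k * (derivative^[2 * r] p).eval π)
        + (-1) ^ m * (1 / (k : ℝ) ^ (2 * m)) *
          ∫ θ in (0 : ℝ)..π, (derivative^[2 * m] p).eval θ * sin (k * θ) := by
  induction m with
  | zero => simp
  | succ m ih =>
    rw [ih, Finset.sum_range_succ, integral_polynomial_mul_sin_step _ k hk,
      ← Function.iterate_succ_apply' derivative, ← Function.iterate_succ_apply' derivative,
      show (2 * m).succ.succ = 2 * (m + 1) by omega]
    have hk' : (k : ℝ) ≠ 0 := Nat.cast_ne_zero.2 hk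
    field_simp
    ring

open Polynomial in
theorem eval_iterate_derivative (p : ℝ[X]) (x : ℝ) (j : ℕ) :
    (derivative^[j] p).eval x = j.factorial * (taylor x p).coeff j := by
  rw [taylor_coeff, ← factorial_smul_hasseDeriv]
  simp

open Polynomial in
theorem factorial_mul_coeff (m n j : ℕ) (x : ℝ) (hj : j ≤ m + n) :
    (j.factorial : ℝ) * (1 / (m.factorial * n.factorial) * ((X + C x) ^ m * X ^ n).coeff j)
      = j.choose n * (x ^ (m + n - j) / (m + n - j).factorial) := by
  rw [coeff_mul_X_pow']
  split_ifs with h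
  · rw [coeff_X_add_C_pow, Nat.cast_choose ℝ h, Nat.cast_choose ℝ (show j - n ≤ m by omega),
      show m - (j - n) = m + n - j by omega]
    field_simp
  · rw [Nat.choose_eq_zero_of_lt (by omega)]
    simp

open Polynomial in
/-- The polynomial `(π - X)^{2a+1}/(2a+1)! · X^{2b+2}/(2b+2)!`. -/
noncomputable def cotPoly (a b : ℕ) : ℝ[X] :=
  C (1 / (((2 * a + 1).factorial : ℝ) * (2 * b + 2).factorial)) *
    ((C π - X) ^ (2 * a + 1) * X ^ (2 * b + 2))

theorem eval_cotPoly (a b : ℕ) (φ : ℝ) : (cotPoly a b).eval (2 * φ) = cotWeight a b φ := by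
  simp only [cotPoly, cotWeight, piSubPow, twoMulPow, Polynomial.eval_mul, Polynomial.eval_C,
    Polynomial.eval_pow, Polynomial.eval_sub, Polynomial.eval_X]
  field_simp

open Polynomial in
theorem natDegree_cotPoly_lt (a b : ℕ) : (cotPoly a b).natDegree < 2 * (a + b + 2) := by
  refine lt_of_le_of_lt (natDegree_C_mul_le _ _) ?_
  refine lt_of_le_of_lt natDegree_mul_le ?_
  have h1 : ((C π - X : ℝ[X]) ^ (2 * a + 1)).natDegree ≤ (2 * a + 1) * 1 := by
    refine natDegree_pow_le_of_le _ ?_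
    exact (natDegree_sub_le _ _).trans (by simp)
  have h2 : ((X : ℝ[X]) ^ (2 * b + 2)).natDegree = 2 * b + 2 := natDegree_X_pow _
  omega

open Polynomial in
theorem eval_zero_iterate_derivative_cotPoly (a b r : ℕ) (hr : r ≤ a + b + 1) :
    (derivative^[2 * r] (cotPoly a b)).eval 0 = (2 * r).choose (2 * b + 2) *
      (π * mzv (List.replicate (a + b + 1 - r) 2)) := by
  have h := factorial_mul_coeff (2 * a + 1) (2 * b + 2) (2 * r) (-π) (by omega)
  have e : 2 * a + 1 + (2 * b + 2) - 2 * r = 2 * (a + b + 1 - r) + 1 := by omega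
  have hp : (C π - X : ℝ[X]) ^ (2 * a + 1) = -(X + C (-π)) ^ (2 * a + 1) := by
    rw [← Odd.neg_pow ⟨a, rfl⟩]; congr 1; rw [C_neg]; ring
  rw [e, Odd.neg_pow ⟨_, rfl⟩] at h
  rw [eval_iterate_derivative, taylor_zero, cotPoly, coeff_C_mul, hp, neg_mul, coeff_neg,
    mzv_replicate_two]
  linear_combination -h

open Polynomial in
theorem eval_pi_iterate_derivative_cotPoly (a b r : ℕ) (hr : r ≤ a + b + 1) :
    (derivative^[2 * r] (cotPoly a b)).eval π = -((2 * r).choose (2 * a + 1) *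
      (π * mzv (List.replicate (a + b + 1 - r) 2))) := by
  have h := factorial_mul_coeff (2 * b + 2) (2 * a + 1) (2 * r) π (by omega)
  have e : 2 * b + 2 + (2 * a + 1) - 2 * r = 2 * (a + b + 1 - r) + 1 := by omega
  have hp : taylor π ((C π - X : ℝ[X]) ^ (2 * a + 1) * X ^ (2 * b + 2))
      = -((X + C π) ^ (2 * b + 2) * X ^ (2 * a + 1)) := by
    rw [taylor_apply, mul_comp, pow_comp, pow_comp, sub_comp, C_comp, X_comp,
      show (C π - (X + C π) : ℝ[X]) = -X by ring, Odd.neg_pow ⟨a, rfl⟩]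
    ring
  rw [e] at h
  rw [eval_iterate_derivative, cotPoly, taylor_mul, taylor_C, coeff_C_mul, hp, coeff_neg,
    mzv_replicate_two]
  linear_combination -h

/-! ### Alternating zeta values and the conclusion -/

theorem hasSum_one_div_succ_pow (r : ℕ) (hr : r ≠ 0) :
    HasSum (fun k : ℕ => 1 / ((k + 1 : ℕ) : ℝ) ^ (2 * r + 1)) (mzv [2 * r + 1]) := by
  have hs : Summable fun n : ℕ => 1 / (n : ℝ) ^ (2 * r + 1) :=
    Real.summable_one_div_nat_pow.2 (by omega)
  have h := (hasSum_nat_add_iff' 1).2 hs.hasSum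
  rw [← mzv_singleton _ (by omega)] at h
  simpa using h

theorem hasSum_alternating_succ_pow (r : ℕ) (hr : r ≠ 0) :
    HasSum (fun k : ℕ => (-1) ^ (k + 1) * (1 / ((k + 1 : ℕ) : ℝ) ^ (2 * r + 1)))
      (-(1 - (2 : ℝ) ^ (-(2 * (r : ℤ)))) * mzv [2 * r + 1]) := by
  have hs : Summable fun n : ℕ => 1 / (n : ℝ) ^ (2 * r + 1) :=
    Real.summable_one_div_nat_pow.2 (by omega)
  have hz : HasSum (fun n : ℕ => 1 / (n : ℝ) ^ (2 * r + 1)) (mzv [2 * r + 1]) := by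
    rw [mzv_singleton _ (by omega)]; exact hs.hasSum
  have he : HasSum (fun n : ℕ => 1 / ((2 * n : ℕ) : ℝ) ^ (2 * r + 1))
      (1 / 2 ^ (2 * r + 1) * mzv [2 * r + 1]) := by
    refine (hz.mul_left (1 / 2 ^ (2 * r + 1))).congr_fun fun n => ?_
    push_cast
    rw [mul_pow, one_div_mul_one_div]
  have ho : Summable fun n : ℕ => 1 / ((2 * n + 1 : ℕ) : ℝ) ^ (2 * r + 1) :=
    hs.comp_injective (i := fun n : ℕ => 2 * n + 1) fun i j hij => by simpa using hij
  have htot := (he.even_add_odd (f := fun n : ℕ => 1 / (n : ℝ) ^ (2 * r + 1)) ho.hasSum).unique hz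
  have halt : HasSum (fun n : ℕ => (-1) ^ n * (1 / (n : ℝ) ^ (2 * r + 1)))
      (1 / 2 ^ (2 * r + 1) * mzv [2 * r + 1]
        + -∑' n : ℕ, 1 / ((2 * n + 1 : ℕ) : ℝ) ^ (2 * r + 1)) := by
    refine HasSum.even_add_odd ?_ ?_
    · simpa using he
    · simpa [pow_succ] using ho.hasSum.neg
  have h := (hasSum_nat_add_iff' 1).2 halt
  have hval : 1 / 2 ^ (2 * r + 1) * mzv [2 * r + 1]
        + -∑' n : ℕ, 1 / ((2 * n + 1 : ℕ) : ℝ) ^ (2 * r + 1)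
      = -(1 - (2 : ℝ) ^ (-(2 * (r : ℤ)))) * mzv [2 * r + 1] := by
    have hp : (2 : ℝ) ^ (-(2 * (r : ℤ))) = 2 * (1 / 2 ^ (2 * r + 1)) := by
      rw [zpow_neg, show (2 * (r : ℤ)) = ((2 * r : ℕ) : ℤ) by push_cast; ring, zpow_natCast,
        pow_succ]
      field_simp
    rw [hp]
    linear_combination -htot
  rw [hval] at h
  simpa using h

theorem integral_cotWeight_mul_sin (a b k : ℕ) :
    ∫ φ in (0 : ℝ)..π / 2, 2 * (cotWeight a b φ * sin (2 * ((k : ℝ) + 1) * φ))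
      = ∑ r ∈ range (a + b + 2), (-1) ^ r * (π * mzv (List.replicate (a + b + 1 - r) 2)) *
        ((2 * r).choose (2 * b + 2) * (1 / ((k + 1 : ℕ) : ℝ) ^ (2 * r + 1))
          + (2 * r).choose (2 * a + 1) *
            ((-1) ^ (k + 1) * (1 / ((k + 1 : ℕ) : ℝ) ^ (2 * r + 1)))) := by
  have h1 : ∫ φ in (0 : ℝ)..π / 2, 2 * (cotWeight a b φ * sin (2 * ((k : ℝ) + 1) * φ))
      = ∫ θ in (0 : ℝ)..π, (cotPoly a b).eval θ * sin ((k + 1 : ℕ) * θ) := by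
    have h := intervalIntegral.integral_comp_mul_left (a := 0) (b := π / 2)
      (fun θ => (cotPoly a b).eval θ * sin ((k + 1 : ℕ) * θ)) (two_ne_zero (α := ℝ))
    rw [mul_zero, mul_div_cancel₀ π two_ne_zero] at h
    rw [intervalIntegral.integral_const_mul]
    have h3 : ∀ φ : ℝ, cotWeight a b φ * sin (2 * ((k : ℝ) + 1) * φ)
        = (cotPoly a b).eval (2 * φ) * sin ((k + 1 : ℕ) * (2 * φ)) := by
      intro φ
      rw [eval_cotPoly]
      push_cast
      ring_nf
    simp only [h3, h, smul_eq_mul]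
    ring
  rw [h1, integral_polynomial_mul_sin _ _ (Nat.add_one_ne_zero k) (a + b + 2),
    Polynomial.iterate_derivative_eq_zero (natDegree_cotPoly_lt a b)]
  simp only [Polynomial.eval_zero, zero_mul, intervalIntegral.integral_zero, mul_zero, add_zero]
  refine Finset.sum_congr rfl fun r hr => ?_
  have hr' : r ≤ a + b + 1 := by rw [Finset.mem_range] at hr; omega
  rw [eval_zero_iterate_derivative_cotPoly a b r hr', eval_pi_iterate_derivative_cotPoly a b r hr']
  ring

theorem cotIntegral_eq (a b : ℕ) :
    ∫ φ in (0 : ℝ)..π / 2, cos φ * (cotWeight a b φ / sin φ)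
      = ∑ r ∈ range (a + b + 2), (-1) ^ r * (π * mzv (List.replicate (a + b + 1 - r) 2)) *
        (((2 * r).choose (2 * b + 2) - (1 - (2 : ℝ) ^ (-(2 * (r : ℤ)))) *
          (2 * r).choose (2 * a + 1)) * mzv [2 * r + 1]) := by
  refine tendsto_nhds_unique (tendsto_sum_integral_sin a b) ?_
  refine HasSum.tendsto_sum_nat ?_
  simp only [integral_cotWeight_mul_sin]
  refine hasSum_sum fun r _ => ?_
  refine HasSum.mul_left _ ?_
  rcases eq_or_ne r 0 with rfl | hr
  · simp
  · convert ((hasSum_one_div_succ_pow r hr).mul_left ((2 * r).choose (2 * b + 2) : ℝ)).add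
      ((hasSum_alternating_succ_pow r hr).mul_left ((2 * r).choose (2 * a + 1) : ℝ)) using 1
    ring

end ZagierFormula

/-- Zagier: for all `a, b ≥ 0`,
`ζ({2}^a, 3, {2}^b) = Σ_{r=1}^{a+b+1} c_{a,b}^r · ζ(2r+1) · ζ({2}^{a+b+1−r})`. -/
theorem zagier_formula (a b : ℕ) :
    mzv (List.replicate a 2 ++ 3 :: List.replicate b 2) =
      ∑ r ∈ Finset.Icc 1 (a + b + 1),
        cZ a b r * mzv [2 * r + 1] * mzv (List.replicate (a + b + 1 - r) 2) := by
  rw [ZagierFormula.mzv_eq_cotIntegral, ZagierFormula.cotIntegral_eq, Finset.mul_sum,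
    Finset.range_eq_Ico, Finset.sum_eq_sum_Ico_succ_bot (by omega)]
  simp only [mul_zero, Nat.choose_zero_succ, Nat.cast_zero, sub_zero, zero_mul, zero_add]
  refine Finset.sum_congr rfl fun r _ => ?_
  have := pi_pos.ne'
  rw [cZ]
  push_cast
  field_simp
end

section
/- (Zagier) For all integers a, b ≥ 0 one has the integral representation ζ({2}^a, 3, {2}^b) = (π^{2a} · 2^{2b+3}) / ((2a+1)! · (2b+2)!) · ∫₀^{π/2} x^{2b+2} · (1 − 2x/π)^{2a+1} · cot(x) dx, where the integral converges. -/
open Real MeasureTheory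
open scoped ENNReal

/-- The normalised central binomial coefficient `binom(2n, n) / 4^n`. -/
noncomputable def wallisRatio (n : ℕ) : ℝ := (Nat.centralBinom n : ℝ) / 4 ^ n

lemma wallisRatio_zero : wallisRatio 0 = 1 := by simp [wallisRatio]

lemma wallisRatio_pos (n : ℕ) : 0 < wallisRatio n := by
  have := Nat.centralBinom_pos n
  unfold wallisRatio
  positivity

lemma wallisRatio_succ (n : ℕ) :
    (2 * n + 2) * wallisRatio (n + 1) = (2 * n + 1) * wallisRatio n := by
  have h : ((n : ℝ) + 1) * Nat.centralBinom (n + 1) = 2 * (2 * n + 1) * Nat.centralBinom n := by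
    exact_mod_cast Nat.succ_mul_centralBinom_succ n
  unfold wallisRatio
  rw [pow_succ]
  field_simp
  linear_combination 2 * h

lemma one_le_succ_mul_wallisRatio (n : ℕ) : 1 ≤ (n + 1) * wallisRatio n := by
  induction n with
  | zero => simp [wallisRatio_zero]
  | succ n ih =>
    have h := wallisRatio_succ n
    have hp := wallisRatio_pos n
    push_cast
    nlinarith

lemma hasDerivAt_cos_pow_even (n : ℕ) (y : ℝ) :
    HasDerivAt (fun y => cos y ^ (2 * n + 2)) (-(2 * n + 2) * cos y ^ (2 * n + 1) * sin y) y := by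
  refine ((hasDerivAt_cos y).fun_pow (2 * n + 2)).congr_deriv ?_
  push_cast
  ring

lemma hasDerivAt_deriv_cos_pow_even (n : ℕ) (y : ℝ) :
    HasDerivAt (fun y => -(2 * n + 2) * cos y ^ (2 * n + 1) * sin y)
      ((2 * n + 2) * ((2 * n + 1) * cos y ^ (2 * n) - (2 * n + 2) * cos y ^ (2 * n + 2))) y := by
  refine ((((hasDerivAt_cos y).fun_pow (2 * n + 1)).const_mul (-(2 * n + 2 : ℝ))).fun_mul
    (hasDerivAt_sin y)).congr_deriv ?_
  push_cast
  have : sin y * sin y = 1 - cos y ^ 2 := by rw [← sq, sin_sq]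
  linear_combination (2 * n + 2) * (2 * n + 1) * cos y ^ (2 * n) * this

lemma integral_mul_cos_pow_even {f f' f'' : ℝ → ℝ} (hf : ∀ y, HasDerivAt f (f' y) y)
    (hf' : ∀ y, HasDerivAt f' (f'' y) y) (hc : Continuous f'') (h0 : f' 0 = 0) (n : ℕ) :
    (2 * n + 2) * ((2 * n + 1) * (∫ y in (0 : ℝ)..(π / 2), f y * cos y ^ (2 * n))
      - (2 * n + 2) * ∫ y in (0 : ℝ)..(π / 2), f y * cos y ^ (2 * (n + 1)))
      = ∫ y in (0 : ℝ)..(π / 2), f'' y * cos y ^ (2 * (n + 1)) := by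
  have hfc : Continuous f := continuous_iff_continuousAt.2 fun y => (hf y).continuousAt
  have key : ∫ y in (0 : ℝ)..(π / 2),
      ((2 * n + 2) * ((2 * n + 1) * (f y * cos y ^ (2 * n))
        - (2 * n + 2) * (f y * cos y ^ (2 * (n + 1)))) - f'' y * cos y ^ (2 * (n + 1))) = 0 := by
    rw [intervalIntegral.integral_eq_sub_of_hasDerivAt
      (f := fun y => f y * (-(2 * n + 2) * cos y ^ (2 * n + 1) * sin y)
        - f' y * cos y ^ (2 * n + 2))]
    · simp [h0]
    · intro y _
      refine (((hf y).fun_mul (hasDerivAt_deriv_cos_pow_even n y)).fun_sub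
        ((hf' y).fun_mul (hasDerivAt_cos_pow_even n y))).congr_deriv ?_
      ring
    · exact Continuous.intervalIntegrable (by fun_prop) _ _
  rw [intervalIntegral.integral_sub (Continuous.intervalIntegrable (by fun_prop) _ _)
    (Continuous.intervalIntegrable (by fun_prop) _ _), intervalIntegral.integral_const_mul,
    intervalIntegral.integral_sub (Continuous.intervalIntegrable (by fun_prop) _ _)
    (Continuous.intervalIntegrable (by fun_prop) _ _), intervalIntegral.integral_const_mul,
    intervalIntegral.integral_const_mul] at key
  linarith

/-- The divided power `(2x)^m / m!`. -/
noncomputable def doubledDividedPow (m : ℕ) (x : ℝ) : ℝ := (2 * x) ^ m / (m.factorial : ℝ)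

lemma doubledDividedPow_zero : doubledDividedPow 0 = fun _ => 1 := by
  ext x
  simp [doubledDividedPow]

lemma hasDerivAt_doubledDividedPow (m : ℕ) (x : ℝ) :
    HasDerivAt (doubledDividedPow (m + 1)) (2 * doubledDividedPow m x) x := by
  have h := (((hasDerivAt_id' x).const_mul 2).fun_pow (m + 1)).div_const ((m + 1).factorial : ℝ)
  refine h.congr_deriv ?_
  have : (m.factorial : ℝ) ≠ 0 := by positivity
  rw [doubledDividedPow, Nat.factorial_succ, Nat.add_sub_cancel]
  push_cast
  field_simp

lemma hasDerivAt_two_mul_doubledDividedPow (m : ℕ) (x : ℝ) :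
    HasDerivAt (fun x => 2 * doubledDividedPow (m + 1) x) (4 * doubledDividedPow m x) x := by
  refine ((hasDerivAt_doubledDividedPow m x).const_mul 2).congr_deriv ?_
  ring

lemma continuous_doubledDividedPow (m : ℕ) : Continuous (doubledDividedPow m) := by
  unfold doubledDividedPow
  fun_prop

/-- The moment `∫₀^{π/2} (2y)^{2a}/(2a)! cos^{2n} y dy`, normalised to equal `1` for `a = 0`. -/
noncomputable def cosMoment (a n : ℕ) : ℝ :=
  2 / (π * wallisRatio n) *
    ∫ y in (0 : ℝ)..(π / 2), doubledDividedPow (2 * a) y * cos y ^ (2 * n)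

lemma integral_eq_cosMoment (a n : ℕ) :
    ∫ y in (0 : ℝ)..(π / 2), doubledDividedPow (2 * a) y * cos y ^ (2 * n)
      = π / 2 * wallisRatio n * cosMoment a n := by
  have := wallisRatio_pos n
  have := pi_pos
  rw [cosMoment]
  field_simp

lemma cosMoment_nonneg (a n : ℕ) : 0 ≤ cosMoment a n := by
  have := wallisRatio_pos n
  have := pi_pos
  refine mul_nonneg (by positivity) (intervalIntegral.integral_nonneg (by positivity) ?_)
  intro y hy
  have h0 := hy.1
  rw [pow_mul]
  unfold doubledDividedPow
  positivity

lemma cosMoment_zero (n : ℕ) : cosMoment 0 n = 1 := by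
  induction n with
  | zero =>
    simp [cosMoment, doubledDividedPow, wallisRatio_zero]
  | succ n ih =>
    have h := integral_mul_cos_pow_even (f := doubledDividedPow 0) (f' := fun _ => 0)
      (f'' := fun _ => 0)
      (fun y => by simpa [doubledDividedPow_zero] using hasDerivAt_const y (1 : ℝ))
      (fun y => hasDerivAt_const y 0) continuous_const rfl n
    have e1 := integral_eq_cosMoment 0 n
    have e2 := integral_eq_cosMoment 0 (n + 1)
    rw [mul_zero] at e1 e2
    rw [e1, e2, ih] at h
    simp only [zero_mul, intervalIntegral.integral_zero] at h
    have hw := wallisRatio_succ n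
    have hp : (2 * n + 2) * (2 * n + 1) * (π / 2 * wallisRatio n) ≠ 0 := by
      have := wallisRatio_pos n
      positivity
    refine mul_left_cancel₀ hp ?_
    linear_combination -h - (2 * n + 2) * (π / 2) * cosMoment 0 (n + 1) * hw

lemma cosMoment_sub_succ (a n : ℕ) :
    cosMoment (a + 1) n - cosMoment (a + 1) (n + 1)
      = cosMoment a (n + 1) / ((n + 1 : ℕ) : ℝ) ^ 2 := by
  have h := integral_mul_cos_pow_even (f := doubledDividedPow (2 * a + 2))
    (f' := fun y => 2 * doubledDividedPow (2 * a + 1) y)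
    (f'' := fun y => 4 * doubledDividedPow (2 * a) y)
    (hasDerivAt_doubledDividedPow _) (hasDerivAt_two_mul_doubledDividedPow _)
    (continuous_const.mul (continuous_doubledDividedPow _)) (by simp [doubledDividedPow]) n
  have e1 := integral_eq_cosMoment (a + 1) n
  have e2 := integral_eq_cosMoment (a + 1) (n + 1)
  have e3 := integral_eq_cosMoment a (n + 1)
  simp only [mul_assoc (4 : ℝ), intervalIntegral.integral_const_mul] at h
  rw [show 2 * a + 2 = 2 * (a + 1) by ring, e1, e2, e3] at h
  have hw := wallisRatio_succ n
  have hp : π / 2 * wallisRatio (n + 1) ≠ 0 := by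
    have := wallisRatio_pos (n + 1)
    positivity
  rw [eq_div_iff (by positivity)]
  refine mul_left_cancel₀ hp ?_
  push_cast
  linear_combination h / 4 + (2 * n + 2) * π / 8 * cosMoment (a + 1) n * hw

lemma tendsto_cosMoment (a : ℕ) :
    Filter.Tendsto (cosMoment (a + 1)) Filter.atTop (nhds 0) := by
  set C : ℝ := π ^ (2 * (a + 1)) / ((2 * (a + 1)).factorial : ℝ) with hC
  have hbound : ∀ n, cosMoment (a + 1) n ≤ C * (1 / ((n : ℝ) + 1)) := by
    intro n
    have hw := wallisRatio_pos n
    have hI : ∫ y in (0 : ℝ)..(π / 2), doubledDividedPow (2 * (a + 1)) y * cos y ^ (2 * n)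
        ≤ ∫ y in (0 : ℝ)..(π / 2), C * (doubledDividedPow (2 * 0) y * cos y ^ (2 * n)
          - doubledDividedPow (2 * 0) y * cos y ^ (2 * (n + 1))) := by
      have := continuous_doubledDividedPow
      refine intervalIntegral.integral_mono_on (by positivity)
        (Continuous.intervalIntegrable (by fun_prop) _ _)
        (Continuous.intervalIntegrable (by fun_prop) _ _) ?_
      intro y hy
      have h1 : 2 * y ≤ π * sin y := by
        have := Real.mul_le_sin hy.1 hy.2
        field_simp at this
        linarith
      have hs : 0 ≤ sin y := sin_nonneg_of_nonneg_of_le_pi hy.1 (by linarith [hy.2, pi_pos])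
      have h2 : (2 * y) ^ (2 * (a + 1)) ≤ π ^ (2 * (a + 1)) * sin y ^ 2 := by
        calc (2 * y) ^ (2 * (a + 1)) ≤ (π * sin y) ^ (2 * (a + 1)) :=
              pow_le_pow_left₀ (by linarith [hy.1]) h1 _
          _ = π ^ (2 * (a + 1)) * sin y ^ (2 * (a + 1)) := mul_pow _ _ _
          _ ≤ _ := by
              gcongr ?_ * ?_
              exact pow_le_pow_of_le_one hs (sin_le_one y) (by omega)
      have e : C * (doubledDividedPow (2 * 0) y * cos y ^ (2 * n)
          - doubledDividedPow (2 * 0) y * cos y ^ (2 * (n + 1)))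
          = π ^ (2 * (a + 1)) * sin y ^ 2 / ((2 * (a + 1)).factorial : ℝ) * cos y ^ (2 * n) := by
        rw [hC, sin_sq]
        simp [doubledDividedPow]
        ring
      rw [e, doubledDividedPow]
      have : 0 ≤ cos y ^ (2 * n) := by rw [pow_mul]; positivity
      gcongr
    have hc := continuous_doubledDividedPow
    rw [intervalIntegral.integral_const_mul,
      intervalIntegral.integral_sub (Continuous.intervalIntegrable (by fun_prop) _ _)
      (Continuous.intervalIntegrable (by fun_prop) _ _), integral_eq_cosMoment,
      integral_eq_cosMoment, integral_eq_cosMoment, cosMoment_zero, cosMoment_zero] at hI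
    have hws := wallisRatio_succ n
    have hd : wallisRatio n - wallisRatio (n + 1) ≤ wallisRatio n * (1 / ((n : ℝ) + 1)) := by
      rw [mul_one_div, le_div_iff₀ (by positivity)]
      nlinarith
    have hCpos : 0 < C := by positivity
    refine le_of_mul_le_mul_left (a := π / 2 * wallisRatio n) ?_ (by positivity)
    calc _ ≤ _ := hI
      _ = π / 2 * C * (wallisRatio n - wallisRatio (n + 1)) := by ring
      _ ≤ π / 2 * C * (wallisRatio n * (1 / ((n : ℝ) + 1))) := by gcongr
      _ = _ := by ring
  refine squeeze_zero (cosMoment_nonneg _) hbound ?_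
  simpa using tendsto_one_div_add_atTop_nhds_zero_nat.const_mul C

lemma hasSum_cosMoment (a n : ℕ) :
    HasSum (fun k : ℕ => cosMoment a (n + k + 1) / ((n + k + 1 : ℕ) : ℝ) ^ 2)
      (cosMoment (a + 1) n) := by
  rw [hasSum_iff_tendsto_nat_of_nonneg
    (fun k => div_nonneg (cosMoment_nonneg _ _) (by positivity))]
  have h : ∀ N, ∑ k ∈ Finset.range N, cosMoment a (n + k + 1) / ((n + k + 1 : ℕ) : ℝ) ^ 2
      = cosMoment (a + 1) n - cosMoment (a + 1) (N + n) := by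
    intro N
    simp only [← cosMoment_sub_succ]
    have := Finset.sum_range_sub' (fun k => cosMoment (a + 1) (n + k)) N
    simpa [add_assoc, add_comm N n] using this
  simp only [h]
  simpa using ((Filter.tendsto_add_atTop_iff_nat n).2 (tendsto_cosMoment a)).const_sub
    (cosMoment (a + 1) n)

/-- The nested sum `Σ_{N > n₁ > ⋯ > n_d > 0} 1/(n₁^{k₁} ⋯ n_d^{k_d})` in `[0, ∞]`. -/
noncomputable def truncatedMzv (ks : List ℕ) (N : ℕ∞) : ℝ≥0∞ :=
  ∑' n : {f : Fin ks.length → ℕ // StrictAnti f ∧ ∀ i, 0 < f i ∧ (f i : ℕ∞) < N},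
    ∏ i : Fin ks.length, ENNReal.ofReal (1 / ((n.1 i : ℝ) ^ ks.get i))

lemma mzv_eq_toReal_truncatedMzv (ks : List ℕ) : mzv ks = (truncatedMzv ks ⊤).toReal := by
  rw [truncatedMzv, ENNReal.tsum_toReal_eq
    (fun f => ENNReal.prod_ne_top fun i _ => ENNReal.ofReal_ne_top), mzv]
  have h : ∀ f : Fin ks.length → ℕ, (StrictAnti f ∧ ∀ i, 0 < f i ∧ (f i : ℕ∞) < ⊤) ↔
      (StrictAnti f ∧ ∀ i, 0 < f i) := by simp
  rw [← (Equiv.subtypeEquivRight h).tsum_eq]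
  refine tsum_congr fun f => ?_
  rw [ENNReal.toReal_prod]
  refine Finset.prod_congr rfl fun i _ => ?_
  rw [ENNReal.toReal_ofReal (by positivity)]
  rfl

lemma truncatedMzv_nil (N : ℕ∞) : truncatedMzv [] N = 1 := by
  have : Unique {f : Fin ([] : List ℕ).length → ℕ //
      StrictAnti f ∧ ∀ i, 0 < f i ∧ (f i : ℕ∞) < N} :=
    { default := ⟨fun _ => 0, fun i => i.elim0, fun i => i.elim0⟩
      uniq := fun f => Subtype.ext (funext fun i => i.elim0) }
  rw [truncatedMzv, tsum_eq_single default (fun f hf => absurd (Unique.eq_default f) hf)]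
  simp

lemma strictAnti_cons_iff {d n : ℕ} {f : Fin d → ℕ} :
    StrictAnti (Fin.cons n f : Fin (d + 1) → ℕ) ↔ StrictAnti f ∧ ∀ i, f i < n := by
  constructor
  · intro h
    exact ⟨fun i j hij => by simpa using h (Fin.succ_lt_succ_iff.2 hij),
      fun i => by simpa using h (Fin.succ_pos i)⟩
  · rintro ⟨h, hn⟩ i j
    refine Fin.cases ?_ (fun i => ?_) i <;> refine Fin.cases ?_ (fun j => ?_) j
    · simp
    · simpa using hn j
    · simp
    · simpa using fun hij => h hij

lemma truncatedMzv_cons (k : ℕ) (ks : List ℕ) (N : ℕ∞) :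
    truncatedMzv (k :: ks) N = ∑' n : ℕ, if 0 < n ∧ (n : ℕ∞) < N then
      ENNReal.ofReal (1 / (n : ℝ) ^ k) * truncatedMzv ks n else 0 := by
  let e : {f : Fin (k :: ks).length → ℕ // StrictAnti f ∧ ∀ i, 0 < f i ∧ (f i : ℕ∞) < N} ≃
      Σ n : {n : ℕ // 0 < n ∧ (n : ℕ∞) < N}, {f : Fin ks.length → ℕ // StrictAnti f ∧
        ∀ i, 0 < f i ∧ (f i : ℕ∞) < (n : ℕ)} :=
    { toFun := fun f => ⟨⟨f.1 0, f.2.2 0⟩, ⟨fun i => f.1 i.succ,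
        fun i j hij => f.2.1 (Fin.succ_lt_succ_iff.2 hij),
        fun i => ⟨(f.2.2 _).1, by exact_mod_cast f.2.1 (Fin.succ_pos i)⟩⟩⟩
      invFun := fun p => ⟨Fin.cons p.1.1 p.2.1,
        strictAnti_cons_iff.2 ⟨p.2.2.1, fun i => by exact_mod_cast (p.2.2.2 i).2⟩,
        Fin.cases p.1.2 fun i => ⟨(p.2.2.2 i).1, (p.2.2.2 i).2.trans p.1.2.2⟩⟩
      left_inv := fun f => Subtype.ext (Fin.cons_self_tail f.1)
      right_inv := fun p => rfl }
  rw [truncatedMzv, ← e.symm.tsum_eq, ENNReal.tsum_sigma']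
  have h := tsum_subtype {n : ℕ | 0 < n ∧ (n : ℕ∞) < N}
    (fun n => ENNReal.ofReal (1 / (n : ℝ) ^ k) * truncatedMzv ks n)
  simp only [Set.indicator_apply, Set.mem_ofPred_eq] at h
  rw [← h]
  refine tsum_congr fun n => ?_
  rw [truncatedMzv, ← ENNReal.tsum_mul_left]
  refine tsum_congr fun f => ?_
  exact Fin.prod_univ_succ _

/-- The finite nested sum `Σ_{n > n₁ > ⋯ > n_b > 0} 1/(n₁² ⋯ n_b²)`. -/
noncomputable def truncatedZetaTwo : ℕ → ℕ → ℝ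
  | 0, _ => 1
  | b + 1, n => ∑ m ∈ Finset.range n, truncatedZetaTwo b m / (m : ℝ) ^ 2

lemma truncatedZetaTwo_nonneg (b n : ℕ) : 0 ≤ truncatedZetaTwo b n := by
  induction b generalizing n with
  | zero => simp [truncatedZetaTwo]
  | succ b ih => exact Finset.sum_nonneg fun m _ => div_nonneg (ih m) (by positivity)

lemma truncatedMzv_replicate_two (b n : ℕ) :
    truncatedMzv (List.replicate b 2) n = ENNReal.ofReal (truncatedZetaTwo b n) := by
  induction b generalizing n with
  | zero => simp [truncatedZetaTwo, truncatedMzv_nil]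
  | succ b ih =>
    rw [List.replicate_succ, truncatedMzv_cons, truncatedZetaTwo, ENNReal.ofReal_sum_of_nonneg
      (fun m _ => div_nonneg (truncatedZetaTwo_nonneg b m) (by positivity)),
      tsum_eq_sum (s := Finset.range n)]
    · refine Finset.sum_congr rfl fun m hm => ?_
      rw [ih, ← ENNReal.ofReal_mul (by positivity)]
      rcases Nat.eq_zero_or_pos m with rfl | h
      · simp
      · rw [if_pos ⟨h, by exact_mod_cast Finset.mem_range.1 hm⟩]
        congr 1
        ring
    · intro m hm
      rw [if_neg]
      rintro ⟨-, h⟩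
      exact hm (Finset.mem_range.2 (by exact_mod_cast h))

/-- The nested tail sum `Σ_{m₁ > ⋯ > m_a > n} 1/(m₁² ⋯ m_a²)` in `[0, ∞]`. -/
noncomputable def zetaTwoTail : ℕ → ℕ → ℝ≥0∞
  | 0, _ => 1
  | a + 1, n => ∑' m : ℕ, if n < m then
      ENNReal.ofReal (1 / (m : ℝ) ^ 2) * zetaTwoTail a m else 0

lemma tsum_zetaTwoTail_mul_truncatedMzv_cons (a k : ℕ) (ks : List ℕ) :
    ∑' n : ℕ, (if 0 < n then ENNReal.ofReal (1 / (n : ℝ) ^ 2) * zetaTwoTail a n *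
      truncatedMzv (k :: ks) n else 0)
    = ∑' n : ℕ, (if 0 < n then ENNReal.ofReal (1 / (n : ℝ) ^ k) * zetaTwoTail (a + 1) n *
      truncatedMzv ks n else 0) := by
  have h1 : ∀ n : ℕ, (if 0 < n then ENNReal.ofReal (1 / (n : ℝ) ^ 2) * zetaTwoTail a n *
      truncatedMzv (k :: ks) n else 0)
      = ∑' m : ℕ, if 0 < m ∧ m < n then ENNReal.ofReal (1 / (n : ℝ) ^ 2) * zetaTwoTail a n *
        (ENNReal.ofReal (1 / (m : ℝ) ^ k) * truncatedMzv ks m) else 0 := by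
    intro n
    rw [truncatedMzv_cons]
    split_ifs with h
    · simp [← ENNReal.tsum_mul_left]
    · symm
      simp only [ENNReal.tsum_eq_zero]
      intro m
      rw [if_neg (by omega)]
  simp only [h1]
  rw [ENNReal.tsum_comm]
  refine tsum_congr fun m => ?_
  split_ifs with h
  · rw [zetaTwoTail, ← ENNReal.tsum_mul_left, ← ENNReal.tsum_mul_right]
    refine tsum_congr fun n => ?_
    simp only [h, true_and]
    split_ifs
    · ring
    · simp
  · simp [h]

lemma truncatedMzv_replicate_two_append (a k : ℕ) (ks : List ℕ) :
    truncatedMzv (List.replicate a 2 ++ k :: ks) ⊤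
    = ∑' n : ℕ, (if 0 < n then ENNReal.ofReal (1 / (n : ℝ) ^ k) * zetaTwoTail a n *
      truncatedMzv ks n else 0) := by
  induction a generalizing k ks with
  | zero => simp [truncatedMzv_cons, zetaTwoTail]
  | succ a ih =>
    rw [List.replicate_succ', List.append_assoc, List.singleton_append, ih,
      tsum_zetaTwoTail_mul_truncatedMzv_cons]

/-- The coefficient of `sin^{2n+2} x` in the expansion of `(2x)^{2b+2}/(2b+2)!`. -/
noncomputable def sinPowCoeff (b n : ℕ) : ℝ :=
  truncatedZetaTwo b (n + 1) / (((n : ℝ) + 1) ^ 2 * wallisRatio (n + 1))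

lemma sinPowCoeff_nonneg (b n : ℕ) : 0 ≤ sinPowCoeff b n := by
  have := wallisRatio_pos (n + 1)
  have := truncatedZetaTwo_nonneg b (n + 1)
  unfold sinPowCoeff
  positivity

/-- Partial sums of the expansion of `(2x)^{2b+2}/(2b+2)!` in even powers of `sin x`. -/
noncomputable def sinPowSum (b N : ℕ) (x : ℝ) : ℝ :=
  ∑ n ∈ Finset.range N, sinPowCoeff b n * sin x ^ (2 * n + 2)

/-- The derivative of `sinPowSum b N`. -/
noncomputable def sinPowSumDeriv (b N : ℕ) (x : ℝ) : ℝ :=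
  ∑ n ∈ Finset.range N, sinPowCoeff b n * ((2 * n + 2) * sin x ^ (2 * n + 1) * cos x)

lemma hasDerivAt_sinPowSum (b N : ℕ) (x : ℝ) :
    HasDerivAt (sinPowSum b N) (sinPowSumDeriv b N x) x := by
  refine HasDerivAt.fun_sum fun n _ => ?_
  refine (((hasDerivAt_sin x).fun_pow (2 * n + 2)).const_mul _).congr_deriv ?_
  push_cast
  ring

lemma sinPowCoeff_mul (b n : ℕ) (q : ℝ) :
    sinPowCoeff b n * ((2 * n + 2) * ((2 * n + 1) * q ^ n - (2 * n + 2) * q ^ (n + 1)))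
      = 4 * (truncatedZetaTwo b (n + 1) * q ^ n / wallisRatio n
        - truncatedZetaTwo b (n + 1) * q ^ (n + 1) / wallisRatio (n + 1)) := by
  have h := wallisRatio_succ n
  have h1 := wallisRatio_pos n
  have h2 := wallisRatio_pos (n + 1)
  unfold sinPowCoeff
  field_simp
  linear_combination (-truncatedZetaTwo b (n + 1) * q ^ n * 2) * h

lemma hasDerivAt_sinPowSumDeriv (b N : ℕ) (x : ℝ) :
    HasDerivAt (sinPowSumDeriv b N) (4 * ∑ n ∈ Finset.range N,
      (truncatedZetaTwo b (n + 1) * (sin x ^ 2) ^ n / wallisRatio n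
        - truncatedZetaTwo b (n + 1) * (sin x ^ 2) ^ (n + 1) / wallisRatio (n + 1))) x := by
  rw [Finset.mul_sum]
  refine HasDerivAt.fun_sum fun n _ => ?_
  rw [← sinPowCoeff_mul]
  refine (((((hasDerivAt_sin x).fun_pow (2 * n + 1)).const_mul (2 * n + 2 : ℝ)).fun_mul
    (hasDerivAt_cos x)).const_mul _).congr_deriv ?_
  push_cast
  rw [← pow_mul, ← pow_mul]
  have : cos x * cos x = 1 - sin x ^ 2 := by rw [← sq, cos_sq']
  linear_combination sinPowCoeff b n * (2 * n + 2) * (2 * n + 1) * sin x ^ (2 * n) * this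

lemma hasDerivAt_sinPowSumDeriv_zero (N : ℕ) (x : ℝ) :
    HasDerivAt (sinPowSumDeriv 0 N) (4 * (1 - (sin x ^ 2) ^ N / wallisRatio N)) x := by
  refine (hasDerivAt_sinPowSumDeriv 0 N x).congr_deriv ?_
  have := Finset.sum_range_sub' (fun n => (sin x ^ 2) ^ n / wallisRatio n) N
  simpa [truncatedZetaTwo, wallisRatio_zero] using this

lemma hasDerivAt_sinPowSumDeriv_succ (b N : ℕ) (x : ℝ) :
    HasDerivAt (sinPowSumDeriv (b + 1) (N + 1)) (4 * (sinPowSum b N x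
      - truncatedZetaTwo (b + 1) (N + 1) * (sin x ^ 2) ^ (N + 1) / wallisRatio (N + 1))) x := by
  refine (hasDerivAt_sinPowSumDeriv (b + 1) (N + 1) x).congr_deriv ?_
  congr 1
  induction N with
  | zero => simp [truncatedZetaTwo, sinPowSum]
  | succ N ih =>
    rw [Finset.sum_range_succ, ih]
    have h1 : sinPowSum b (N + 1) x
        = sinPowSum b N x + sinPowCoeff b N * (sin x ^ 2) ^ (N + 1) := by
      rw [sinPowSum, Finset.sum_range_succ, ← pow_mul]
      rfl
    have h2 : truncatedZetaTwo (b + 1) (N + 1 + 1) = truncatedZetaTwo (b + 1) (N + 1)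
        + truncatedZetaTwo b (N + 1) / ((N + 1 : ℕ) : ℝ) ^ 2 := by
      rw [truncatedZetaTwo, Finset.sum_range_succ]
      rfl
    have hw := wallisRatio_pos (N + 1)
    have hw' := wallisRatio_pos (N + 1 + 1)
    rw [h1, h2, sinPowCoeff]
    push_cast
    field_simp
    ring

lemma truncatedZetaTwo_le (b n : ℕ) : truncatedZetaTwo b n ≤ (n : ℝ) ^ b := by
  induction b generalizing n with
  | zero => simp [truncatedZetaTwo]
  | succ b ih =>
    calc truncatedZetaTwo (b + 1) n ≤ ∑ m ∈ Finset.range n, (n : ℝ) ^ b := by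
          refine Finset.sum_le_sum fun m hm => ?_
          have hmn : (m : ℝ) ≤ n := by exact_mod_cast (Finset.mem_range.1 hm).le
          rcases Nat.eq_zero_or_pos m with rfl | h
          · simp
          · have h1 : (1 : ℝ) ≤ m := by exact_mod_cast h
            refine (div_le_self (truncatedZetaTwo_nonneg b m) (one_le_pow₀ h1)).trans ?_
            exact (ih m).trans (by gcongr)
      _ = _ := by simp [pow_succ']

lemma tendsto_pow_mul_truncatedZetaTwo_div (b : ℕ) {q : ℝ} (h0 : 0 ≤ q) (h1 : q < 1) :
    Filter.Tendsto (fun N => truncatedZetaTwo b N * q ^ N / wallisRatio N)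
      Filter.atTop (nhds 0) := by
  have hq : |q| < 1 := by rwa [abs_of_nonneg h0]
  refine squeeze_zero (g := fun N : ℕ => (N : ℝ) ^ (b + 1) * q ^ N + (N : ℝ) ^ b * q ^ N)
    (fun N => ?_) (fun N => ?_) ?_
  · have := wallisRatio_pos N
    have := truncatedZetaTwo_nonneg b N
    positivity
  · have hw := wallisRatio_pos N
    rw [div_le_iff₀ hw]
    calc truncatedZetaTwo b N * q ^ N ≤ (N : ℝ) ^ b * q ^ N := by
          gcongr
          exact truncatedZetaTwo_le b N
      _ ≤ (N : ℝ) ^ b * q ^ N * ((N + 1) * wallisRatio N) :=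
          le_mul_of_one_le_right (by positivity) (one_le_succ_mul_wallisRatio N)
      _ = _ := by ring
  · simpa using (tendsto_pow_const_mul_const_pow_of_abs_lt_one (b + 1) hq).add
      (tendsto_pow_const_mul_const_pow_of_abs_lt_one b hq)

lemma abs_le_of_abs_deriv_deriv_le {g g' g'' : ℝ → ℝ} {c ε : ℝ}
    (hg : ∀ x, HasDerivAt g (g' x) x) (hg' : ∀ x, HasDerivAt g' (g'' x) x)
    (h0 : g 0 = 0) (h0' : g' 0 = 0) (hε : ∀ x ∈ Set.Icc 0 c, |g'' x| ≤ ε) :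
    ∀ x ∈ Set.Icc 0 c, |g x| ≤ ε * c * c := by
  intro x hx
  have hc : 0 ≤ c := hx.1.trans hx.2
  have z : (0 : ℝ) ∈ Set.Icc 0 c := ⟨le_rfl, hc⟩
  have hε0 : 0 ≤ ε := (abs_nonneg _).trans (hε 0 z)
  have b1 : ∀ y ∈ Set.Icc 0 c, |g' y| ≤ ε * c := by
    intro y hy
    have := Convex.norm_image_sub_le_of_norm_hasDerivWithin_le
      (fun t _ => (hg' t).hasDerivWithinAt) hε (convex_Icc 0 c) z hy
    rw [h0', sub_zero, sub_zero, norm_eq_abs, norm_eq_abs, abs_of_nonneg hy.1] at this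
    exact this.trans (by gcongr; exact hy.2)
  have := Convex.norm_image_sub_le_of_norm_hasDerivWithin_le
    (fun t _ => (hg t).hasDerivWithinAt) b1 (convex_Icc 0 c) z hx
  rw [h0, sub_zero, sub_zero, norm_eq_abs, norm_eq_abs, abs_of_nonneg hx.1] at this
  exact this.trans (by gcongr; exact hx.2)

lemma exists_tendsto_abs_sub_sinPowSum_le (b : ℕ) {c : ℝ} (hc : c < π / 2) :
    ∃ ε : ℕ → ℝ, Filter.Tendsto ε Filter.atTop (nhds 0) ∧ ∀ N, ∀ x ∈ Set.Icc 0 c,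
      |doubledDividedPow (2 * b + 2) x - sinPowSum b (N + b) x| ≤ ε N := by
  have hsin : ∀ x ∈ Set.Icc 0 c, sin x ^ 2 ≤ sin c ^ 2 := by
    intro x hx
    have h1 : 0 ≤ sin x := sin_nonneg_of_nonneg_of_le_pi hx.1 (by linarith [hx.2, pi_pos])
    have h2 : sin x ≤ sin c := sin_le_sin_of_le_of_le_pi_div_two
      (by linarith [hx.1, pi_pos]) hc.le hx.2
    gcongr
  rcases lt_or_ge c 0 with hneg | hpos
  · exact ⟨fun _ => 0, tendsto_const_nhds, fun N x hx => absurd (hx.1.trans hx.2) hneg.not_ge⟩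
  have hq1 : sin c ^ 2 < 1 := by
    have : 0 < cos c := cos_pos_of_mem_Ioo ⟨by linarith [pi_pos], hc⟩
    nlinarith [sin_sq_add_cos_sq c]
  have hd0 : ∀ b N, sinPowSum b N 0 = 0 := fun b N => by simp [sinPowSum]
  have hd0' : ∀ b N, sinPowSumDeriv b N 0 = 0 := fun b N => by simp [sinPowSumDeriv]
  have hlim := fun b => tendsto_pow_mul_truncatedZetaTwo_div b (sq_nonneg (sin c)) hq1
  have hle : ∀ b N, ∀ x ∈ Set.Icc 0 c, |truncatedZetaTwo b N * (sin x ^ 2) ^ N / wallisRatio N|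
      ≤ truncatedZetaTwo b N * (sin c ^ 2) ^ N / wallisRatio N := by
    intro b N x hx
    have hw := wallisRatio_pos N
    have hA := truncatedZetaTwo_nonneg b N
    rw [abs_of_nonneg (by positivity)]
    have := hsin x hx
    gcongr
  induction b with
  | zero =>
    refine ⟨fun N => 4 * (truncatedZetaTwo 0 N * (sin c ^ 2) ^ N / wallisRatio N) * c * c,
      by simpa using (((hlim 0).const_mul 4).mul_const c).mul_const c, fun N => ?_⟩
    refine abs_le_of_abs_deriv_deriv_le
      (g := fun x => doubledDividedPow (2 * 0 + 2) x - sinPowSum 0 (N + 0) x)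
      (fun x => (hasDerivAt_doubledDividedPow 1 x).fun_sub (hasDerivAt_sinPowSum 0 N x))
      (fun x => (hasDerivAt_two_mul_doubledDividedPow 0 x).fun_sub
        (hasDerivAt_sinPowSumDeriv_zero N x)) (by simp [hd0, doubledDividedPow])
      (by simp [hd0', doubledDividedPow]) fun x hx => ?_
    have h := hle 0 N x hx
    rw [doubledDividedPow_zero, ← mul_sub, abs_mul, abs_of_pos (by norm_num : (0 : ℝ) < 4)]
    simpa [truncatedZetaTwo] using h
  | succ b ih =>
    obtain ⟨ε, hε, hb⟩ := ih
    refine ⟨fun N => 4 * (ε N + truncatedZetaTwo (b + 1) (N + (b + 1)) *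
      (sin c ^ 2) ^ (N + (b + 1)) / wallisRatio (N + (b + 1))) * c * c, ?_, fun N => ?_⟩
    · simpa using (((hε.add ((Filter.tendsto_add_atTop_iff_nat (b + 1)).2
        (hlim (b + 1)))).const_mul 4).mul_const c).mul_const c
    · refine abs_le_of_abs_deriv_deriv_le
        (g := fun x => doubledDividedPow (2 * (b + 1) + 2) x - sinPowSum (b + 1) (N + (b + 1)) x)
        (fun x => (hasDerivAt_doubledDividedPow (2 * (b + 1) + 1) x).fun_sub
          (hasDerivAt_sinPowSum (b + 1) (N + (b + 1)) x))
        (fun x => (hasDerivAt_two_mul_doubledDividedPow (2 * b + 2) x).fun_sub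
          (hasDerivAt_sinPowSumDeriv_succ b (N + b) x)) (by simp [hd0, doubledDividedPow])
        (by simp [hd0', doubledDividedPow]) fun x hx => ?_
      have h1 := hb N x hx
      have h2 := hle (b + 1) (N + (b + 1)) x hx
      rw [← mul_sub, abs_mul, abs_of_pos (by norm_num : (0 : ℝ) < 4), ← sub_add]
      gcongr
      exact (abs_add_le _ _).trans (add_le_add h1 h2)

/-- The expansion of even powers of `x` in powers of `sin x`. -/
lemma hasSum_sinPowCoeff (b : ℕ) {x : ℝ} (h0 : 0 ≤ x) (hx : x < π / 2) :
    HasSum (fun n => sinPowCoeff b n * sin x ^ (2 * n + 2)) (doubledDividedPow (2 * b + 2) x) := by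
  obtain ⟨ε, hε, hb⟩ := exists_tendsto_abs_sub_sinPowSum_le b hx
  have hs : 0 ≤ sin x := sin_nonneg_of_nonneg_of_le_pi h0 (by linarith [pi_pos])
  rw [hasSum_iff_tendsto_nat_of_nonneg
    (fun n => mul_nonneg (sinPowCoeff_nonneg b n) (by positivity)),
    ← Filter.tendsto_add_atTop_iff_nat b, tendsto_iff_norm_sub_tendsto_zero]
  refine squeeze_zero (fun N => norm_nonneg _) (fun N => ?_) hε
  rw [norm_sub_rev]
  exact hb N x ⟨h0, le_rfl⟩

lemma zetaTwoTail_eq_cosMoment (a n : ℕ) :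
    zetaTwoTail a n = ENNReal.ofReal (cosMoment a n) := by
  induction a generalizing n with
  | zero => simp [zetaTwoTail, cosMoment_zero]
  | succ a ih =>
    have h := hasSum_cosMoment a n
    rw [← h.tsum_eq, ENNReal.ofReal_tsum_of_nonneg
      (fun k => div_nonneg (cosMoment_nonneg a _) (by positivity)) h.summable, zetaTwoTail,
      ← Summable.sum_add_tsum_nat_add' (k := n + 1) ENNReal.summable, Finset.sum_eq_zero, zero_add]
    · refine tsum_congr fun k => ?_
      rw [if_pos (by omega), ih, ← ENNReal.ofReal_mul (by positivity),
        show k + (n + 1) = n + k + 1 by omega]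
      congr 1
      ring
    · intro m hm
      rw [if_neg (by have := Finset.mem_range.1 hm; omega)]

lemma mzv_eq_toReal_tsum (a b : ℕ) :
    mzv (List.replicate a 2 ++ 3 :: List.replicate b 2) =
      (∑' n : ℕ, ENNReal.ofReal (truncatedZetaTwo b (n + 1) * cosMoment a (n + 1)
        / ((n : ℝ) + 1) ^ 3)).toReal := by
  rw [mzv_eq_toReal_truncatedMzv, truncatedMzv_replicate_two_append,
    tsum_eq_zero_add' ENNReal.summable, if_neg (lt_irrefl 0), zero_add]
  congr 1
  refine tsum_congr fun n => ?_
  rw [if_pos n.succ_pos, zetaTwoTail_eq_cosMoment, truncatedMzv_replicate_two,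
    ← ENNReal.ofReal_mul (by positivity),
    ← ENNReal.ofReal_mul (mul_nonneg (by positivity) (cosMoment_nonneg _ _))]
  congr 1
  push_cast
  ring

lemma sinc_pos_of_mem_Icc {x : ℝ} (hx : x ∈ Set.Icc 0 (π / 2)) : 0 < sinc x := by
  rcases hx.1.eq_or_lt with rfl | h
  · simp
  · rw [sinc_of_ne_zero h.ne']
    exact div_pos (sin_pos_of_pos_of_lt_pi h (by linarith [hx.2, pi_pos])) h

lemma intervalIntegrable_mul_cot (a b : ℕ) : IntervalIntegrable
    (fun x : ℝ => x ^ (2 * b + 2) * (1 - 2 * x / π) ^ (2 * a + 1) * cot x) volume 0 (π / 2) := by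
  refine ContinuousOn.intervalIntegrable_of_Icc (by positivity) ?_
  refine ContinuousOn.congr
    (f := fun x => x ^ (2 * b + 1) * (1 - 2 * x / π) ^ (2 * a + 1) * cos x / sinc x) ?_ ?_
  · exact ContinuousOn.div (by fun_prop) continuous_sinc.continuousOn
      fun x hx => (sinc_pos_of_mem_Icc hx).ne'
  · intro x hx
    rcases hx.1.eq_or_lt with rfl | h
    · simp
    · have hs : 0 < sin x := sin_pos_of_pos_of_lt_pi h (by linarith [hx.2, pi_pos])
      simp only [sinc_of_ne_zero h.ne', cot_eq_cos_div_sin]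
      field_simp
      ring

lemma integral_sin_pow_mul_cos (a n : ℕ) :
    ∫ x in (0 : ℝ)..(π / 2), sin x ^ (2 * n + 1) * cos x * (1 - 2 * x / π) ^ (2 * a + 1)
      = ((2 * a + 1).factorial : ℝ) / π ^ (2 * a) * wallisRatio (n + 1)
        * cosMoment a (n + 1) / (2 * n + 2) := by
  have hparts : ∫ x in (0 : ℝ)..(π / 2),
      ((2 * n + 2) * (sin x ^ (2 * n + 1) * cos x * (1 - 2 * x / π) ^ (2 * a + 1))
        - (2 * a + 1) * (2 / π) * (sin x ^ (2 * (n + 1)) * (1 - 2 * x / π) ^ (2 * a))) = 0 := by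
    rw [intervalIntegral.integral_eq_sub_of_hasDerivAt
      (f := fun x => sin x ^ (2 * n + 2) * (1 - 2 * x / π) ^ (2 * a + 1))]
    · have : 1 - 2 * (π / 2) / π = 0 := by field_simp; ring
      simp [this]
    · intro x _
      refine (((hasDerivAt_sin x).fun_pow (2 * n + 2)).fun_mul
        (((((hasDerivAt_id' x).const_mul 2).div_const π).const_sub 1).fun_pow
          (2 * a + 1))).congr_deriv ?_
      push_cast
      ring
    · exact Continuous.intervalIntegrable (by fun_prop) _ _
  have hrefl : ∫ x in (0 : ℝ)..(π / 2), sin x ^ (2 * (n + 1)) * (1 - 2 * x / π) ^ (2 * a)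
      = ((2 * a).factorial : ℝ) / π ^ (2 * a) *
        ∫ y in (0 : ℝ)..(π / 2), doubledDividedPow (2 * a) y * cos y ^ (2 * (n + 1)) := by
    rw [← intervalIntegral.integral_const_mul]
    have := intervalIntegral.integral_comp_sub_left (a := 0) (b := π / 2)
      (fun y => ((2 * a).factorial : ℝ) / π ^ (2 * a) *
        (doubledDividedPow (2 * a) y * cos y ^ (2 * (n + 1)))) (π / 2)
    rw [sub_self, sub_zero] at this
    rw [← this]
    refine intervalIntegral.integral_congr fun x _ => ?_
    have h : 1 - 2 * x / π = 2 * (π / 2 - x) / π := by field_simp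
    simp only [cos_pi_div_two_sub, doubledDividedPow, h, div_pow]
    field_simp
  rw [intervalIntegral.integral_sub (Continuous.intervalIntegrable (by fun_prop) _ _)
    (Continuous.intervalIntegrable (by fun_prop) _ _), intervalIntegral.integral_const_mul,
    intervalIntegral.integral_const_mul, hrefl, integral_eq_cosMoment] at hparts
  rw [eq_div_iff (by positivity), mul_comm, sub_eq_zero.1 hparts, Nat.factorial_succ]
  push_cast
  field_simp

lemma lintegral_mul_cot (a b : ℕ) :
    ∫⁻ x in Set.Ioc 0 (π / 2),
      ENNReal.ofReal (x ^ (2 * b + 2) * (1 - 2 * x / π) ^ (2 * a + 1) * cot x)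
    = ∑' n : ℕ, ENNReal.ofReal (((2 * b + 2).factorial : ℝ) / 2 ^ (2 * b + 2) * sinPowCoeff b n *
      ∫ x in (0 : ℝ)..(π / 2), sin x ^ (2 * n + 1) * cos x * (1 - 2 * x / π) ^ (2 * a + 1)) := by
  set C : ℝ := ((2 * b + 2).factorial : ℝ) / 2 ^ (2 * b + 2) with hC
  have hC0 : 0 < C := by positivity
  have hnn : ∀ n, ∀ x ∈ Set.Ioc 0 (π / 2),
      0 ≤ C * sinPowCoeff b n * (sin x ^ (2 * n + 1) * cos x * (1 - 2 * x / π) ^ (2 * a + 1)) := by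
    intro n x hx
    have h1 := sinPowCoeff_nonneg b n
    have h2 : 0 ≤ sin x := sin_nonneg_of_nonneg_of_le_pi hx.1.le (by linarith [hx.2, pi_pos])
    have h3 : 0 ≤ cos x := cos_nonneg_of_mem_Icc ⟨by linarith [hx.1, pi_pos], hx.2⟩
    have h4 : 0 ≤ 1 - 2 * x / π := by
      rw [sub_nonneg, div_le_one pi_pos]
      linarith [hx.2]
    positivity
  have hterm : ∀ n, ENNReal.ofReal (C * sinPowCoeff b n *
      ∫ x in (0 : ℝ)..(π / 2), sin x ^ (2 * n + 1) * cos x * (1 - 2 * x / π) ^ (2 * a + 1))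
      = ∫⁻ x in Set.Ioc 0 (π / 2), ENNReal.ofReal (C * sinPowCoeff b n *
        (sin x ^ (2 * n + 1) * cos x * (1 - 2 * x / π) ^ (2 * a + 1))) := by
    intro n
    rw [← intervalIntegral.integral_const_mul, intervalIntegral.integral_of_le (by positivity)]
    refine ofReal_integral_eq_lintegral_ofReal ?_ ?_
    · exact ((Continuous.intervalIntegrable (by fun_prop) _ _).1)
    · exact (ae_restrict_iff' measurableSet_Ioc).2 (.of_forall (hnn n))
  simp only [hterm]
  rw [← lintegral_tsum (fun n => Measurable.aemeasurable (by fun_prop))]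
  refine setLIntegral_congr_fun measurableSet_Ioc fun x hx => ?_
  rcases hx.2.eq_or_lt with rfl | hlt
  · simp [cot_eq_cos_div_sin]
  · have hs : 0 < sin x := sin_pos_of_pos_of_lt_pi hx.1 (by linarith [pi_pos])
    have h := ((hasSum_sinPowCoeff b hx.1.le hlt).mul_left C).mul_right
      ((1 - 2 * x / π) ^ (2 * a + 1) * cot x)
    have e : ∀ n, C * sinPowCoeff b n *
        (sin x ^ (2 * n + 1) * cos x * (1 - 2 * x / π) ^ (2 * a + 1))
        = C * (sinPowCoeff b n * sin x ^ (2 * n + 2)) *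
          ((1 - 2 * x / π) ^ (2 * a + 1) * cot x) := by
      intro n
      rw [cot_eq_cos_div_sin]
      field_simp
      ring
    have hnn' := fun n => hnn n x hx
    simp only [e] at hnn' ⊢
    rw [← ENNReal.ofReal_tsum_of_nonneg hnn' h.summable, h.tsum_eq, hC, doubledDividedPow, mul_pow]
    congr 1
    field_simp

/-- Zagier: for all `a, b ≥ 0`, the integral
`∫₀^{π/2} x^{2b+2} (1 − 2x/π)^{2a+1} cot(x) dx` converges and
`ζ({2}^a, 3, {2}^b) = (π^{2a} 2^{2b+3})/((2a+1)!(2b+2)!)` times this integral. -/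
theorem zagier_integral_representation (a b : ℕ) :
    IntervalIntegrable
      (fun x : ℝ => x ^ (2 * b + 2) * (1 - 2 * x / π) ^ (2 * a + 1) * Real.cot x)
      volume 0 (π / 2) ∧
    mzv (List.replicate a 2 ++ 3 :: List.replicate b 2) =
      π ^ (2 * a) * 2 ^ (2 * b + 3)
          / ((Nat.factorial (2 * a + 1) : ℝ) * (Nat.factorial (2 * b + 2) : ℝ))
        * ∫ x in (0 : ℝ)..(π / 2),
            x ^ (2 * b + 2) * (1 - 2 * x / π) ^ (2 * a + 1) * Real.cot x := by
  refine ⟨intervalIntegrable_mul_cot a b, ?_⟩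
  have hnn : ∀ x ∈ Set.Ioc 0 (π / 2),
      0 ≤ x ^ (2 * b + 2) * (1 - 2 * x / π) ^ (2 * a + 1) * cot x := by
    intro x hx
    have h1 : 0 < sin x := sin_pos_of_pos_of_lt_pi hx.1 (by linarith [hx.2, pi_pos])
    have h2 : 0 ≤ cos x := cos_nonneg_of_mem_Icc ⟨by linarith [hx.1, pi_pos], hx.2⟩
    have h3 : 0 ≤ 1 - 2 * x / π := by
      rw [sub_nonneg, div_le_one pi_pos]
      linarith [hx.2]
    have h4 := hx.1
    rw [cot_eq_cos_div_sin]
    positivity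
  rw [intervalIntegral.integral_of_le (by positivity), integral_eq_lintegral_of_nonneg_ae
    ((ae_restrict_iff' measurableSet_Ioc).2 (.of_forall hnn))
    (intervalIntegrable_mul_cot a b).1.aestronglyMeasurable, lintegral_mul_cot,
    mzv_eq_toReal_tsum]
  rw [← ENNReal.toReal_ofReal (r := π ^ (2 * a) * 2 ^ (2 * b + 3)
    / ((Nat.factorial (2 * a + 1) : ℝ) * (Nat.factorial (2 * b + 2) : ℝ))) (by positivity),
    ← ENNReal.toReal_mul, ← ENNReal.tsum_mul_left]
  congr 1
  refine tsum_congr fun n => ?_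
  rw [← ENNReal.ofReal_mul (by positivity), integral_sin_pow_mul_cos, sinPowCoeff]
  congr 1
  have hw := wallisRatio_pos (n + 1)
  field_simp
  ring
end
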